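/- arXiv:1804.07054 — 2 statements merged into one kernel-verified Lean document; each statement's English description precedes it below -/
import Mathlib

section
/- Let n ≥ 1 and let b_1 < b_2 < … < b_n be integers. Let GT_n(x_1,…,x_n) = ∏_{1≤i<j≤n} (x_j − x_i + j − i)/(j − i), and for indeterminates u, v define the operator Strict_{x,y} acting on polynomials in x, y (and possibly other variables) by Strict_{x,y} p = u·p(x, y+1) + v·p(x−1, y) + (1−u−v)·p(x−1, y+1); these operators for distinct pairs of variables commute. Set M_n(u,v,x_1,…,x_n) = (∏_{1≤p<q≤n} Strict_{x_q,x_p}) GT_n(x_1,…,x_n). Then M_n(u,v,b_1,…,b_n) = Σ_M u^{inv(M)} v^{inv'(M)}, where the sum is over all monotone triangles M of order n with bottom row (b_1,…,b_n), as an identity of polynomials in u and v. Moreover, in the special case u = v = 1, the equality M_n(1,1,b_1,…,b_n) = #{monotone triangles of order n with bottom row (b_1,…,b_n)} holds under the weaker assumption that b_1 ≤ b_2 ≤ … ≤ b_n. -/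
open scoped BigOperators

/-- The coefficient ring `ℚ[u,v]`. -/
abbrev S2 : Type := MvPolynomial (Fin 2) ℚ

/-- The indeterminate `u`. -/
noncomputable def Uv : S2 := MvPolynomial.X 0

/-- The indeterminate `v`. -/
noncomputable def Vv : S2 := MvPolynomial.X 1

/-- A monotone triangle of order `n` (1-based indices, zero off the shape). -/
def IsMT (n : ℕ) (M : ℕ → ℕ → ℤ) : Prop :=
  (∀ i j, 1 ≤ j → j ≤ i → i < n → M (i+1) j ≤ M i j ∧ M i j ≤ M (i+1) (j+1)) ∧
  (∀ i j, 1 ≤ j → j < i → i < n → M i j < M i (j+1)) ∧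
  (∀ i j, ¬(1 ≤ j ∧ j ≤ i ∧ i ≤ n) → M i j = 0)

/-- `inv(M) = #{(i,j) : 1 ≤ j ≤ i < n, m_{i,j} = m_{i+1,j+1}}`. -/
def invMT (n : ℕ) (M : ℕ → ℕ → ℤ) : ℕ :=
  (((Finset.Icc 1 n) ×ˢ (Finset.Icc 1 n)).filter
    (fun p => p.2 ≤ p.1 ∧ p.1 < n ∧ M p.1 p.2 = M (p.1+1) (p.2+1))).card

/-- `inv'(M) = #{(i,j) : 1 ≤ j ≤ i < n, m_{i,j} = m_{i+1,j}}`. -/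
def invMT' (n : ℕ) (M : ℕ → ℕ → ℤ) : ℕ :=
  (((Finset.Icc 1 n) ×ˢ (Finset.Icc 1 n)).filter
    (fun p => p.2 ≤ p.1 ∧ p.1 < n ∧ M p.1 p.2 = M (p.1+1) p.2)).card

/-- The substitution `x_a ↦ x_a + c` (all other variables fixed), as a ring homomorphism on
`S2[x_1, x_2, …]`. -/
noncomputable def substAdd (a : ℕ) (c : ℤ) :
    MvPolynomial ℕ S2 →+* MvPolynomial ℕ S2 :=
  MvPolynomial.eval₂Hom MvPolynomial.C
    (fun i => if i = a then MvPolynomial.X a + MvPolynomial.C ((c : ℤ) : S2) else MvPolynomial.X i)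

/-- The operator `Strict_{x,y}`:
`(Strict_{x,y} p)(x,y) = u·p(x, y+1) + v·p(x−1, y) + (1−u−v)·p(x−1, y+1)`. -/
noncomputable def StrictOp (x y : ℕ) (f : MvPolynomial ℕ S2) : MvPolynomial ℕ S2 :=
  MvPolynomial.C Uv * substAdd y 1 f + MvPolynomial.C Vv * substAdd x (-1) f +
    MvPolynomial.C (1 - Uv - Vv) * substAdd x (-1) (substAdd y 1 f)

/-- The list of pairs `(p,q)` with `1 ≤ p < q ≤ n`. -/
def strictPairs (n : ℕ) : List (ℕ × ℕ) :=
  ((List.range' 1 n).flatMap fun p => (List.range' 1 n).map fun q => (p, q)).filter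
    fun pq => pq.1 < pq.2

/-- `GT_n(x_1,…,x_n) = ∏_{1≤i<j≤n} (x_j − x_i + j − i)/(j − i)`. -/
noncomputable def GTpoly (n : ℕ) : MvPolynomial ℕ S2 :=
  ∏ p ∈ (Finset.Icc 1 n ×ˢ Finset.Icc 1 n).filter (fun p => p.1 < p.2),
    MvPolynomial.C (algebraMap ℚ S2 (((p.2 : ℚ) - (p.1 : ℚ))⁻¹)) *
      (MvPolynomial.X p.2 - MvPolynomial.X p.1 +
        MvPolynomial.C ((((p.2 : ℤ) - (p.1 : ℤ)) : ℤ) : S2))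

/-- `M_n(u,v,x_1,…,x_n) = (∏_{1≤p<q≤n} Strict_{x_q,x_p}) GT_n(x_1,…,x_n)`
(the operators for distinct pairs commute, so they are applied in a fixed order). -/
noncomputable def Mpoly (n : ℕ) : MvPolynomial ℕ S2 :=
  (strictPairs n).foldr (fun pq g => StrictOp pq.2 pq.1 g) (GTpoly n)

namespace MonotoneTriangle

open Finset

/-- The antisymmetrization of `G`. -/
def alt {n : ℕ} {X A : Type*} [CommRing A] (G : (Fin n → X) → A) (z : Fin n → X) : A :=
  ∑ σ : Equiv.Perm (Fin n), ((Equiv.Perm.sign σ : ℤ) : A) * G (z ∘ σ)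

theorem alt_eq_zero {n : ℕ} {X A : Type*} [CommRing A] (G : (Fin n → X) → A) (z : Fin n → X)
    {a b : Fin n} (hab : a ≠ b) (h : ∀ y, G (y ∘ Equiv.swap a b) = G y) : alt G z = 0 := by
  refine Finset.sum_involution (fun σ _ => σ * Equiv.swap a b) ?_ ?_ ?_ ?_
  · intro σ _
    have : z ∘ ⇑(σ * Equiv.swap a b) = (z ∘ σ) ∘ Equiv.swap a b := by
      rw [Equiv.Perm.coe_mul]; rfl
    rw [this, h]
    simp [Equiv.Perm.sign_swap hab]
  · intro σ _ _ hσ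
    have := Equiv.swap_eq_one_iff.1 (mul_eq_left.1 hσ)
    exact hab this
  · simp
  · intro σ _
    simp [mul_assoc]

theorem alt_cons {n : ℕ} {X A : Type*} [CommRing A] (G : (Fin (n + 1) → X) → A) (x : X)
    (z : Fin n → X) :
    alt G (Fin.cons x z : Fin (n + 1) → X) =
      ∑ m : Fin (n + 1), (-1) ^ (m : ℕ) * alt (fun y => G (m.insertNth x y)) z := by
  let e : Fin (n + 1) × Equiv.Perm (Fin n) → Equiv.Perm (Fin (n + 1)) :=
    fun p => Equiv.Perm.decomposeFin.symm (0, p.2) * p.1.cycleRange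
  have e_self : ∀ p, e p p.1 = 0 := by
    intro p
    simp [e]
  have e_succAbove : ∀ p j, e p (p.1.succAbove j) = (p.2 j).succ := by
    intro p j
    simp [e, Fin.cycleRange_succAbove]
  have hinj : Function.Injective e := by
    rintro ⟨m, σ⟩ ⟨m', σ'⟩ h
    have h1 := e_self (m, σ)
    have h2 := e_self (m', σ')
    rw [← h, ← h1] at h2
    obtain rfl : m' = m := (e (m, σ)).injective h2
    congr 1
    ext j : 1
    have h3 := e_succAbove (m', σ) j
    rw [h, e_succAbove (m', σ') j] at h3
    exact (Fin.succ_injective _ h3).symm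
  have hbij : Function.Bijective e := by
    rw [Fintype.bijective_iff_injective_and_card]
    refine ⟨hinj, ?_⟩
    simp [Fintype.card_perm, Nat.factorial_succ]
  unfold alt
  simp only [Finset.mul_sum]
  rw [← Finset.sum_product', Finset.univ_product_univ]
  symm
  refine Fintype.sum_bijective e hbij _ _ ?_
  rintro ⟨m, σ⟩
  have hz : (Fin.cons x z : Fin (n + 1) → X) ∘ e (m, σ) = m.insertNth x (z ∘ σ) := by
    funext i
    refine Fin.succAboveCases m ?_ ?_ i
    · simp [e_self (m, σ)]
    · intro j
      simp [e_succAbove (m, σ) j]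
  rw [hz]
  have hs : Equiv.Perm.sign (e (m, σ)) = Equiv.Perm.sign σ * (-1) ^ (m : ℕ) := by
    simp [e, Equiv.Perm.decomposeFin.symm_sign]
  rw [hs]
  push_cast
  ring

/-- The weights of the three terms of the operator `Strict`. -/
def cutWt {A : Type*} [CommRing A] (u v : A) : Fin 3 → A := ![u, v, 1 - u - v]

/-- The shifts of the first variable in the three terms of the operator `Strict`. -/
def shL : Fin 3 → ℤ := ![0, -1, -1]

/-- The shifts of the second variable in the three terms of the operator `Strict`. -/
def shR : Fin 3 → ℤ := ![1, 0, 1]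

/-- The symbol of the operator `Strict`. -/
def symb {A : Type*} [CommRing A] (u v : A) (x y : Aˣ) : A :=
  ∑ c, cutWt u v c * ((x ^ shL c * y ^ shR c : Aˣ) : A)

theorem symb_one {A : Type*} [CommRing A] (u v : A) : symb u v 1 1 = 1 := by
  simp [symb, Fin.sum_univ_three, cutWt]

/-- The product of the symbols of `Strict` over all pairs. -/
def symbProd {A : Type*} [CommRing A] (u v : A) {n : ℕ} (y : Fin n → Aˣ) : A :=
  ∏ i, ∏ j, if i < j then symb u v (y j) (y i) else 1

theorem symbProd_insertNth {A : Type*} [CommRing A] (u v : A) {n : ℕ} (m : Fin (n + 1))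
    (y : Fin n → Aˣ) :
    symbProd u v (m.insertNth 1 y : Fin (n + 1) → Aˣ) =
      symbProd u v y * ∏ j, if m < m.succAbove j then symb u v (y j) 1 else symb u v 1 (y j) := by
  unfold symbProd
  rw [Fin.prod_univ_succAbove _ m, Fin.prod_univ_succAbove _ m]
  simp only [Fin.prod_univ_succAbove _ m, Fin.insertNth_apply_same, Fin.insertNth_apply_succAbove,
    lt_irrefl, if_false, one_mul, Fin.succAbove_lt_succAbove_iff]
  rw [Finset.prod_mul_distrib, ← mul_assoc, ← Finset.prod_mul_distrib, mul_comm]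
  congr 1
  refine Finset.prod_congr rfl fun j _ => ?_
  rcases lt_or_gt_of_ne (Fin.succAbove_ne m j) with h | h
  · simp [h, h.not_gt]
  · simp [h, h.not_gt]

theorem symbProd_swap {A : Type*} [CommRing A] (u v : A) {n : ℕ} {a b : Fin n}
    (hab : (b : ℕ) = a + 1) (y : Fin n → Aˣ) :
    symbProd u v (y ∘ Equiv.swap a b) * symb u v (y b) (y a) =
      symbProd u v y * symb u v (y a) (y b) := by
  have hlt : a < b := by rw [Fin.lt_def]; omega
  let D : Finset (Fin n × Fin n) := insert (b, a) (univ.filter fun p => p.1 < p.2)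
  have key : ∀ x : Fin n → Aˣ,
      symbProd u v x * symb u v (x a) (x b) = ∏ p ∈ D, symb u v (x p.2) (x p.1) := by
    intro x
    rw [Finset.prod_insert (by simp [hlt.le]), Finset.prod_filter, ← Finset.univ_product_univ,
      Finset.prod_product, mul_comm]
    rfl
  have h1 := key (y ∘ Equiv.swap a b)
  simp only [Function.comp_apply, Equiv.swap_apply_left, Equiv.swap_apply_right] at h1
  rw [h1, key]
  refine Finset.prod_equiv (Equiv.prodCongr (Equiv.swap a b) (Equiv.swap a b)) ?_ ?_
  · rintro ⟨i, j⟩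
    simp only [D, Finset.mem_insert, Finset.mem_filter, Finset.mem_univ, true_and, Prod.mk.injEq,
      Equiv.prodCongr_apply, Prod.map_apply, Equiv.swap_apply_def, Fin.lt_def, Fin.ext_iff]
    split_ifs <;> omega
  · rintro ⟨i, j⟩ _
    rfl

/-- The Bethe-type alternating sum whose image under a suitable functional is `M_n`. -/
def bethe {A : Type*} [CommRing A] (u v : A) {n : ℕ} (k : Fin n → ℤ) (z : Fin n → Aˣ) : A :=
  alt (fun y => symbProd u v y * ((∏ j, y j ^ (k j + (j : ℤ)) : Aˣ) : A)) z

/-- The variables attached to the upper end points of the summation intervals. -/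
def upperVar {A : Type*} [CommRing A] {n : ℕ} (ε : Fin n → Bool) (y : Fin n → Aˣ) :
    Fin (n + 1) → Aˣ :=
  Fin.cons 1 fun i => if ε i then y i else 1

/-- The variables attached to the lower end points of the summation intervals. -/
def lowerVar {A : Type*} [CommRing A] {n : ℕ} (ε : Fin n → Bool) (y : Fin n → Aˣ) :
    Fin (n + 1) → Aˣ :=
  Fin.snoc (α := fun _ => Aˣ) (fun i => if ε i then 1 else y i) 1

/-- The contribution of a choice `ε` of end points of the summation intervals. -/
def endTerm {A : Type*} [CommRing A] (u v : A) {n : ℕ} (k : Fin (n + 1) → ℤ) (ε : Fin n → Bool)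
    (y : Fin n → Aˣ) : A :=
  (∏ i, if ε i then (1 : A) else -1) * ∏ i, symb u v (upperVar ε y i) (lowerVar ε y i) *
    ((upperVar ε y i ^ (k i + 1) * lowerVar ε y i ^ k i : Aˣ) : A)

theorem prod_zpow_swap {G : Type*} [CommGroup G] {n : ℕ} {a b : Fin n} (hab : (b : ℕ) = a + 1)
    (y : Fin n → G) :
    (∏ j, (y ∘ Equiv.swap a b) j ^ (j : ℤ)) * y b = (∏ j, y j ^ (j : ℤ)) * y a := by
  have h1 : ∏ j, (y ∘ Equiv.swap a b) j ^ (j : ℤ) =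
      ∏ j, y j ^ ((Equiv.swap a b j : Fin n) : ℤ) := by
    rw [← Equiv.prod_comp (Equiv.swap a b)]
    simp
  have h2 : ∀ c, y c = ∏ j, if j = c then y j else 1 := by simp
  rw [h1, h2 a, h2 b, ← Finset.prod_mul_distrib, ← Finset.prod_mul_distrib]
  refine Finset.prod_congr rfl fun j _ => ?_
  have hne : a ≠ b := by rintro rfl; omega
  rw [Equiv.swap_apply_def]
  by_cases ha : j = a
  · subst ha
    simp [hne, hab, zpow_add]
  · by_cases hb : j = b
    · subst hb
      simp [hne.symm, hab, ← pow_succ]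
      norm_cast
    · simp [ha, hb]

theorem alt_endTerm_eq_zero {A : Type*} [CommRing A] (u v : A) {n : ℕ} (k : Fin (n + 1) → ℤ)
    (ε : Fin n → Bool) (z : Fin n → Aˣ) {a b : Fin n} (hab : (b : ℕ) = a + 1)
    (ha : ε a = true) (hb : ε b = false) :
    alt (fun y => symbProd u v y * ((∏ j, y j ^ (j : ℤ) : Aˣ) : A) * endTerm u v k ε y) z = 0 := by
  have hne : a ≠ b := by rintro rfl; omega
  refine alt_eq_zero _ z hne fun y => ?_
  set y' := y ∘ Equiv.swap a b with hy'
  have hi : b.castSucc = a.succ := by ext; simp [hab]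
  have hu0 : ∀ x : Fin n → Aˣ, upperVar ε x a.succ = x a := by
    intro x; simp [upperVar, ha]
  have hl0 : ∀ x : Fin n → Aˣ, lowerVar ε x a.succ = x b := by
    intro x; rw [← hi]; simp [lowerVar, hb]
  have hu : ∀ i ∈ univ.erase a.succ, upperVar ε y' i = upperVar ε y i := by
    intro i hi
    refine Fin.cases ?_ (fun j hj => ?_) i (Finset.ne_of_mem_erase hi)
    · simp [upperVar]
    · have hja : j ≠ a := fun h => hj (by rw [h])
      by_cases hjb : j = b
      · subst hjb; simp [upperVar, hb]
      · simp [upperVar, hy', Equiv.swap_apply_of_ne_of_ne hja hjb]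
  have hl : ∀ i ∈ univ.erase a.succ, lowerVar ε y' i = lowerVar ε y i := by
    intro i hi'
    refine Fin.lastCases ?_ (fun j hj => ?_) i (Finset.ne_of_mem_erase hi')
    · simp [lowerVar]
    · have hjb : j ≠ b := fun h => hj (by rw [h, hi])
      by_cases hja : j = a
      · subst hja; simp [lowerVar, ha]
      · simp [lowerVar, hy', Equiv.swap_apply_of_ne_of_ne hja hjb]
  have hrest : ∏ i ∈ univ.erase a.succ, symb u v (upperVar ε y' i) (lowerVar ε y' i) *
        ((upperVar ε y' i ^ (k i + 1) * lowerVar ε y' i ^ k i : Aˣ) : A) =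
      ∏ i ∈ univ.erase a.succ, symb u v (upperVar ε y i) (lowerVar ε y i) *
        ((upperVar ε y i ^ (k i + 1) * lowerVar ε y i ^ k i : Aˣ) : A) :=
    Finset.prod_congr rfl fun i hi => by rw [hu i hi, hl i hi]
  unfold endTerm
  rw [← Finset.mul_prod_erase univ _ (Finset.mem_univ a.succ),
    ← Finset.mul_prod_erase univ _ (Finset.mem_univ a.succ),
    hrest, hu0, hl0, hu0, hl0]
  have e1 : y' a = y b := by simp [hy']
  have e2 : y' b = y a := by simp [hy']
  have h1 := symbProd_swap u v hab y
  have h2 := congrArg (Units.val) (prod_zpow_swap hab y)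
  rw [← hy'] at h1 h2
  rw [e1, e2, zpow_add_one, zpow_add_one]
  simp only [Units.val_mul] at h2 ⊢
  generalize ((y a ^ k a.succ : Aˣ) : A) = p at *
  generalize ((y b ^ k a.succ : Aˣ) : A) = q at *
  generalize (∏ x ∈ univ.erase a.succ, symb u v (upperVar ε y x) (lowerVar ε y x) *
    (((upperVar ε y x ^ (k x + 1) : Aˣ) : A) * ((lowerVar ε y x ^ k x : Aˣ) : A))) = r at *
  generalize ((∏ j, y' j ^ (j : ℤ) : Aˣ) : A) = s at *
  generalize ((∏ j, y j ^ (j : ℤ) : Aˣ) : A) = t at *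
  generalize (∏ i, if ε i = true then (1 : A) else -1) = w
  linear_combination (s * w * p * q * r * y b) * h1 +
    (symbProd u v y * symb u v (y a) (y b) * w * p * q * r) * h2

theorem endTerm_threshold {A : Type*} [CommRing A] (u v : A) {n : ℕ} (k : Fin (n + 1) → ℤ)
    (m : Fin (n + 1)) (y : Fin n → Aˣ) :
    symbProd u v y * ((∏ j, y j ^ (j : ℤ) : Aˣ) : A) *
        endTerm u v k (fun i => decide (m ≤ i.castSucc)) y =
      (-1) ^ (m : ℕ) * (symbProd u v (m.insertNth 1 y : Fin (n + 1) → Aˣ) *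
        ((∏ j, (m.insertNth 1 y : Fin (n + 1) → Aˣ) j ^ (k j + (j : ℤ)) : Aˣ) : A)) := by
  have hsgn : (∏ i : Fin n, if decide (m ≤ i.castSucc) = true then (1 : A) else -1) =
      (-1) ^ (m : ℕ) := by
    rw [Finset.prod_ite, Finset.prod_const_one, one_mul, Finset.prod_const]
    congr 1
    have : (univ.filter fun i : Fin n => ¬ decide (m ≤ i.castSucc) = true) =
        univ.filter fun i : Fin n => (i : ℕ) < m := by
      ext i; simp [Fin.lt_def]
    rw [this, Fin.card_filter_val_lt]
    omega
  have hmm : upperVar (fun i => decide (m ≤ i.castSucc)) y m = 1 ∧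
      lowerVar (fun i => decide (m ≤ i.castSucc)) y m = 1 := by
    constructor
    · refine Fin.cases ?_ (fun j => ?_) m
      · simp [upperVar]
      · simp [upperVar, Fin.le_def]
    · refine Fin.lastCases ?_ (fun j => ?_) m
      · simp [lowerVar]
      · simp [lowerVar]
  have hlt : ∀ j, m < m.succAbove j →
      upperVar (fun i => decide (m ≤ i.castSucc)) y (m.succAbove j) = y j ∧
      lowerVar (fun i => decide (m ≤ i.castSucc)) y (m.succAbove j) = 1 ∧
        ((m.succAbove j : Fin (n + 1)) : ℤ) = j + 1 := by
    intro j hj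
    have h : m ≤ j.castSucc := by rwa [Fin.lt_succAbove_iff_le_castSucc] at hj
    rw [Fin.succAbove_of_le_castSucc _ _ h]
    refine ⟨by simp [upperVar, h], ?_, by simp⟩
    have : ∀ i : Fin (n + 1), m ≤ i → lowerVar (fun i => decide (m ≤ i.castSucc)) y i = 1 := by
      intro i
      refine Fin.lastCases ?_ (fun i hi => ?_) i
      · simp [lowerVar]
      · simp [lowerVar, hi]
    exact this _ (h.trans (Fin.castSucc_lt_succ).le)
  have hgt : ∀ j, ¬ m < m.succAbove j →
      upperVar (fun i => decide (m ≤ i.castSucc)) y (m.succAbove j) = 1 ∧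
      lowerVar (fun i => decide (m ≤ i.castSucc)) y (m.succAbove j) = y j ∧
        ((m.succAbove j : Fin (n + 1)) : ℤ) = j := by
    intro j hj
    have h : j.castSucc < m := by
      rw [Fin.lt_succAbove_iff_le_castSucc] at hj; exact not_le.1 hj
    rw [Fin.succAbove_of_castSucc_lt _ _ h]
    refine ⟨?_, by simp [lowerVar, h.not_ge], by simp⟩
    have : ∀ i : Fin (n + 1), i < m → upperVar (fun i => decide (m ≤ i.castSucc)) y i = 1 := by
      intro i
      refine Fin.cases ?_ (fun i hi => ?_) i
      · simp [upperVar]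
      · have : ¬ m ≤ i.castSucc := not_le.2 ((Fin.castSucc_lt_succ).trans hi)
        simp [upperVar, this]
    exact this _ h
  rw [symbProd_insertNth]
  unfold endTerm
  rw [hsgn, Fin.prod_univ_succAbove _ m, Fin.prod_univ_succAbove _ m, hmm.1, hmm.2, symb_one,
    Fin.insertNth_apply_same]
  simp only [Fin.insertNth_apply_succAbove, one_zpow, one_mul, Units.val_one]
  have hpt : ∀ j, ((y j ^ (j : ℤ) : Aˣ) : A) *
      (symb u v (upperVar (fun i => decide (m ≤ i.castSucc)) y (m.succAbove j))
          (lowerVar (fun i => decide (m ≤ i.castSucc)) y (m.succAbove j)) *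
        ((upperVar (fun i => decide (m ≤ i.castSucc)) y (m.succAbove j) ^ (k (m.succAbove j) + 1) *
          lowerVar (fun i => decide (m ≤ i.castSucc)) y (m.succAbove j) ^ k (m.succAbove j) : Aˣ) :
            A)) =
      (if m < m.succAbove j then symb u v (y j) 1 else symb u v 1 (y j)) *
        ((y j ^ (k (m.succAbove j) + ((m.succAbove j : Fin (n + 1)) : ℤ)) : Aˣ) : A) := by
    intro j
    by_cases h : m < m.succAbove j
    · obtain ⟨h1, h2, h3⟩ := hlt j h
      rw [h1, h2, h3, if_pos h, one_zpow, mul_one, mul_left_comm, ← Units.val_mul, ← zpow_add]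
      congr 3
      ring_nf
    · obtain ⟨h1, h2, h3⟩ := hgt j h
      rw [h1, h2, h3, if_neg h, one_zpow, one_mul, mul_left_comm, ← Units.val_mul, ← zpow_add]
      congr 3
      ring_nf
  have hprod := Finset.prod_congr (rfl : (univ : Finset (Fin n)) = univ) fun j _ => hpt j
  simp only [Finset.prod_mul_distrib] at hprod ⊢
  rw [Units.coe_prod, Units.coe_prod]
  linear_combination (symbProd u v y * (-1) ^ (m : ℕ)) * hprod

theorem exists_threshold {n : ℕ} (ε : Fin n → Bool)
    (h : ∀ a b : Fin n, (b : ℕ) = a + 1 → ε a = true → ε b = true) :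
    ∃ m : Fin (n + 1), ε = fun i => decide (m ≤ i.castSucc) := by
  have up : ∀ d : ℕ, ∀ a b : Fin n, (b : ℕ) = a + d → ε a = true → ε b = true := by
    intro d
    induction d with
    | zero => intro a b hab ha; rwa [show b = a from Fin.ext hab]
    | succ d ih =>
      intro a b hab ha
      exact h ⟨a + d, by omega⟩ b (by simp; omega) (ih a ⟨a + d, by omega⟩ rfl ha)
  by_cases hex : ∃ a : ℕ, ∃ ha : a < n, ε ⟨a, ha⟩ = true
  · classical
    obtain ⟨hm, hε⟩ := Nat.find_spec hex
    refine ⟨⟨Nat.find hex, by omega⟩, ?_⟩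
    funext i
    by_cases hi : Nat.find hex ≤ i
    · rw [up (i - Nat.find hex) ⟨Nat.find hex, hm⟩ i (by simp; omega) hε]
      simp only [Fin.le_def, Fin.val_castSucc, hi, decide_true]
    · have := Nat.find_min hex (not_le.1 hi)
      have h2 : ε i ≠ true := fun h => this ⟨i.2, h⟩
      simp only [Fin.le_def, Fin.val_castSucc, hi, decide_false]
      simpa using h2
  · refine ⟨Fin.last n, ?_⟩
    funext i
    have h2 : ε i ≠ true := fun h => hex ⟨i, i.2, h⟩
    simpa [Fin.last_le_iff] using h2

theorem sum_alt_endTerm {A : Type*} [CommRing A] (u v : A) {n : ℕ} (k : Fin (n + 1) → ℤ)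
    (z : Fin n → Aˣ) :
    ∑ ε : Fin n → Bool,
        alt (fun y => symbProd u v y * ((∏ j, y j ^ (j : ℤ) : Aˣ) : A) * endTerm u v k ε y) z =
      bethe u v k (Fin.cons 1 z) := by
  classical
  let f : Fin (n + 1) → Fin n → Bool := fun m i => decide (m ≤ i.castSucc)
  have hf : Function.Injective f := by
    intro m m' h
    have key : ∀ i : ℕ, i < n → ((m : ℕ) ≤ i ↔ (m' : ℕ) ≤ i) := by
      intro i hi
      have := congrFun h ⟨i, hi⟩
      simpa [f, Fin.le_def] using this
    ext
    by_contra hne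
    rcases lt_or_gt_of_ne hne with h1 | h1
    · have := (key m (by omega)).1 le_rfl
      omega
    · have := (key m' (by omega)).2 le_rfl
      omega
  rw [bethe, alt_cons]
  symm
  refine Finset.sum_of_injOn f hf.injOn (by simp) ?_ ?_
  · intro ε _ hε
    by_contra hne
    apply hε
    obtain ⟨m, hm⟩ := exists_threshold ε fun a b hab ha => by
      by_contra hb
      exact hne (alt_endTerm_eq_zero u v k ε z hab ha (by simpa using hb))
    exact ⟨m, by simp, hm.symm⟩
  · intro m _
    rw [alt, alt, Finset.mul_sum]
    refine Finset.sum_congr rfl fun σ _ => ?_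
    rw [endTerm_threshold]
    ring

/-- The signed indicator function of the interval `[r, s]`, where `s < r` is allowed. -/
def ind (A : Type*) [CommRing A] (r s l : ℤ) : A :=
  (if r ≤ l then 1 else 0) - (if s < l then 1 else 0)

theorem map_cutWt {A B : Type*} [CommRing A] [CommRing B] (φ : A →+* B) (u v : A) (c : Fin 3) :
    φ (cutWt u v c) = cutWt (φ u) (φ v) c := by
  fin_cases c <;> simp [cutWt]

/-- The weight with which the row `l` contributes to the row `k` below it. -/
def rowWt {A : Type*} [CommRing A] (u v : A) {n : ℕ} (k : Fin (n + 1) → ℤ) (l : Fin n → ℤ) : A :=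
  ∑ c : Fin (n + 1) → Fin 3, (∏ i, cutWt u v (c i)) *
    ∏ i : Fin n, ind A (k i.castSucc + shR (c i.castSucc)) (k i.succ + shL (c i.succ)) (l i)

theorem map_rowWt {A B : Type*} [CommRing A] [CommRing B] (φ : A →+* B) (u v : A) {n : ℕ}
    (k : Fin (n + 1) → ℤ) (l : Fin n → ℤ) : φ (rowWt u v k l) = rowWt (φ u) (φ v) k l := by
  simp [rowWt, ind, map_cutWt, apply_ite φ]

theorem sum_Icc_zpow {A : Type*} [CommRing A] (y : Aˣ) (c : ℤ) (d : ℕ) :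
    ∑ l ∈ Icc c (c - 1 + d), ((y ^ l : Aˣ) : A) * ((y : A) - 1) =
      ((y ^ (c + d) : Aˣ) : A) - ((y ^ c : Aˣ) : A) := by
  induction d with
  | zero => simp
  | succ d ih =>
    have : Icc c (c - 1 + ((d + 1 : ℕ) : ℤ)) = insert (c + d) (Icc c (c - 1 + d)) := by
      ext x
      simp only [Finset.mem_Icc, Finset.mem_insert]
      push_cast
      omega
    rw [this, Finset.sum_insert (by simp), ih]
    have : c + ((d + 1 : ℕ) : ℤ) = c + d + 1 := by push_cast; ring
    rw [this, zpow_add_one y (c + d)]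
    push_cast
    ring

theorem sum_Icc_ite_zpow {A : Type*} [CommRing A] (y : Aˣ) {a b c : ℤ} (hac : a ≤ c)
    (hcb : c ≤ b + 1) :
    ∑ l ∈ Icc a b, (if c ≤ l then 1 else 0) * (((y ^ l : Aˣ) : A) * ((y : A) - 1)) =
      ((y ^ (b + 1) : Aˣ) : A) - ((y ^ c : Aˣ) : A) := by
  obtain ⟨d, hd⟩ := Int.le.dest hcb
  rw [← hd, ← sum_Icc_zpow]
  have : Icc c (c - 1 + d) = (Icc a b).filter fun l => c ≤ l := by
    ext x
    simp only [Finset.mem_Icc, Finset.mem_filter]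
    omega
  rw [this, Finset.sum_filter]
  simp

theorem sum_Icc_ind_zpow {A : Type*} [CommRing A] (y : Aˣ) {a b r s : ℤ} (har : a ≤ r)
    (hrb : r ≤ b + 1) (has : a ≤ s + 1) (hsb : s ≤ b) :
    ∑ l ∈ Icc a b, ind A r s l * (((y ^ l : Aˣ) : A) * ((y : A) - 1)) =
      ((y ^ (s + 1) : Aˣ) : A) - ((y ^ r : Aˣ) : A) := by
  simp only [ind, sub_mul, Finset.sum_sub_distrib]
  rw [sum_Icc_ite_zpow y har hrb]
  simp only [← Int.add_one_le_iff]
  rw [sum_Icc_ite_zpow y has (by omega)]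
  ring

theorem shL_shR_bounds (c : Fin 3) : (-1 ≤ shL c ∧ shL c ≤ 0) ∧ 0 ≤ shR c ∧ shR c ≤ 1 := by
  fin_cases c <;> simp [shL, shR]

theorem sum_rowWt_mul {A : Type*} [CommRing A] (u v : A) {n : ℕ} (k : Fin (n + 1) → ℤ)
    (hk : ∀ i : Fin n, k i.castSucc ≤ k i.succ) (y : Fin n → Aˣ) :
    ∑ l ∈ Fintype.piFinset fun i : Fin n => Icc (k i.castSucc) (k i.succ),
        rowWt u v k l * ∏ i, ((y i ^ l i : Aˣ) : A) * ((y i : A) - 1) =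
      ∑ ε, endTerm u v k ε y := by
  have h1 : ∑ l ∈ Fintype.piFinset fun i : Fin n => Icc (k i.castSucc) (k i.succ),
        rowWt u v k l * ∏ i, ((y i ^ l i : Aˣ) : A) * ((y i : A) - 1) =
      ∑ c : Fin (n + 1) → Fin 3, (∏ i, cutWt u v (c i)) *
        ∏ i : Fin n, (((y i ^ (k i.succ + shL (c i.succ) + 1) : Aˣ) : A) -
          ((y i ^ (k i.castSucc + shR (c i.castSucc)) : Aˣ) : A)) := by
    simp only [rowWt, Finset.sum_mul]
    rw [Finset.sum_comm]
    refine Finset.sum_congr rfl fun c _ => ?_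
    simp only [mul_assoc, ← Finset.mul_sum, ← Finset.prod_mul_distrib]
    congr 1
    rw [← Finset.prod_univ_sum (fun i : Fin n => Icc (k i.castSucc) (k i.succ)) fun i l =>
      ind A (k i.castSucc + shR (c i.castSucc)) (k i.succ + shL (c i.succ)) l *
        (((y i ^ l : Aˣ) : A) * ((y i : A) - 1))]
    refine Finset.prod_congr rfl fun i _ => ?_
    have := hk i
    have b1 := shL_shR_bounds (c i.succ)
    have b2 := shL_shR_bounds (c i.castSucc)
    exact sum_Icc_ind_zpow (y i) (by omega) (by omega) (by omega) (by omega)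
  have h2 : ∀ ε, endTerm u v k ε y = ∑ c : Fin (n + 1) → Fin 3, (∏ i, cutWt u v (c i)) *
      ∏ i : Fin n, if ε i then ((y i ^ (k i.succ + shL (c i.succ) + 1) : Aˣ) : A) else
          -((y i ^ (k i.castSucc + shR (c i.castSucc)) : Aˣ) : A) := by
    intro ε
    have : ∀ i, symb u v (upperVar ε y i) (lowerVar ε y i) *
        ((upperVar ε y i ^ (k i + 1) * lowerVar ε y i ^ k i : Aˣ) : A) =
        ∑ c : Fin 3, cutWt u v c * (((upperVar ε y i ^ (k i + shL c + 1) : Aˣ) : A) *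
          ((lowerVar ε y i ^ (k i + shR c) : Aˣ) : A)) := by
      intro i
      rw [symb, Finset.sum_mul]
      refine Finset.sum_congr rfl fun c _ => ?_
      rw [mul_assoc, ← Units.val_mul, ← Units.val_mul]
      congr 2
      rw [add_right_comm (k i), zpow_add _ _ (shL c), zpow_add _ _ (shR c)]
      ac_rfl
    rw [endTerm]
    simp only [this]
    rw [Finset.prod_univ_sum, Fintype.piFinset_univ, Finset.mul_sum]
    refine Finset.sum_congr rfl fun c _ => ?_
    simp only [Finset.prod_mul_distrib]
    rw [Fin.prod_univ_succ fun i => ((upperVar ε y i ^ (k i + shL (c i) + 1) : Aˣ) : A),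
      Fin.prod_univ_castSucc fun i => ((lowerVar ε y i ^ (k i + shR (c i)) : Aˣ) : A)]
    simp only [upperVar, lowerVar, Fin.cons_zero, Fin.cons_succ, Fin.snoc_last, Fin.snoc_castSucc,
      one_zpow, Units.val_one, one_mul, mul_one]
    rw [mul_left_comm, ← Finset.prod_mul_distrib, ← Finset.prod_mul_distrib]
    congr 1
    refine Finset.prod_congr rfl fun i _ => ?_
    cases ε i <;> simp
  rw [h1]
  simp only [h2]
  rw [Finset.sum_comm]
  refine Finset.sum_congr rfl fun c _ => ?_
  rw [← Finset.mul_sum]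
  congr 1
  have := Finset.prod_univ_sum (fun _ : Fin n => (univ : Finset Bool)) fun i e =>
    if e then ((y i ^ (k i.succ + shL (c i.succ) + 1) : Aˣ) : A) else
          -((y i ^ (k i.castSucc + shR (c i.castSucc)) : Aˣ) : A)
  rw [Fintype.piFinset_univ] at this
  rw [← this]
  refine Finset.prod_congr rfl fun i _ => ?_
  simp [sub_eq_add_neg]

/-- Summation of the alternating sums over the row above. -/
theorem sum_rowWt_mul_bethe {A : Type*} [CommRing A] (u v : A) {n : ℕ} (k : Fin (n + 1) → ℤ)
    (hk : ∀ i : Fin n, k i.castSucc ≤ k i.succ) (z : Fin n → Aˣ) :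
    (∑ l ∈ Fintype.piFinset fun i : Fin n => Icc (k i.castSucc) (k i.succ),
        rowWt u v k l * bethe u v l z) * ∏ i, ((z i : A) - 1) =
      bethe u v k (Fin.cons 1 z) := by
  rw [← sum_alt_endTerm, Finset.sum_mul]
  simp only [bethe, alt, Finset.mul_sum, Finset.sum_mul]
  rw [Finset.sum_comm, Finset.sum_comm (s := univ (α := Fin n → Bool))]
  refine Finset.sum_congr rfl fun σ _ => ?_
  rw [← Finset.mul_sum, ← Finset.mul_sum, ← sum_rowWt_mul u v k hk, Finset.mul_sum, Finset.mul_sum]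
  refine Finset.sum_congr rfl fun l _ => ?_
  rw [← Equiv.prod_comp σ fun i => ((z i : A) - 1)]
  simp only [zpow_add, Finset.prod_mul_distrib, Units.val_mul, Units.coe_prod, Function.comp_apply]
  ring

/-- One step of the transfer recursion computing `rowWt`. -/
def transferStep {A : Type*} [CommRing A] (u v : A) (kL kR l : ℤ) (s : A × A) : A × A :=
  (v * (s.1 * ind A kL (kR - 1) l + s.2 * ind A (kL + 1) (kR - 1) l),
    u * (s.1 * ind A kL kR l + s.2 * ind A (kL + 1) kR l) +
      (1 - u - v) * (s.1 * ind A kL (kR - 1) l + s.2 * ind A (kL + 1) (kR - 1) l))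

/-- The state of the transfer recursion computing `rowWt`. -/
def transfer {A : Type*} [CommRing A] (u v : A) (k l : ℕ → ℤ) : ℕ → A × A
  | 0 => (v, 1 - v)
  | n + 1 => transferStep u v (k n) (k (n + 1)) (l n) (transfer u v k l n)

theorem sum_eq_transfer {A : Type*} [CommRing A] (u v : A) (k l : ℕ → ℤ) (n : ℕ) (h : ℤ → A) :
    ∑ c : Fin (n + 1) → Fin 3, (∏ i, cutWt u v (c i)) *
        (∏ i : Fin n, ind A (k i + shR (c i.castSucc)) (k (i + 1) + shL (c i.succ)) (l i)) *
          h (shR (c (Fin.last n))) =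
      (transfer u v k l n).1 * h 0 + (transfer u v k l n).2 * h 1 := by
  induction n generalizing h with
  | zero =>
    rw [← (Equiv.funUnique (Fin 1) (Fin 3)).symm.sum_comp]
    simp [Fin.sum_univ_three, cutWt, shR, transfer]
    ring
  | succ n ih =>
    rw [← (Fin.snocEquiv fun _ => Fin 3).sum_comp, Fintype.sum_prod_type, Finset.sum_comm]
    have h1 := ih fun ρ => ∑ c : Fin 3, cutWt u v c * ind A (k n + ρ) (k (n + 1) + shL c) (l n) *
      h (shR c)
    have h2 : ∀ s : A × A,
        s.1 * (∑ c : Fin 3, cutWt u v c * ind A (k n + 0) (k (n + 1) + shL c) (l n) * h (shR c)) +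
          s.2 * (∑ c : Fin 3, cutWt u v c * ind A (k n + 1) (k (n + 1) + shL c) (l n) *
            h (shR c)) =
        (transferStep u v (k n) (k (n + 1)) (l n) s).1 * h 0 +
          (transferStep u v (k n) (k (n + 1)) (l n) s).2 * h 1 := by
      intro s
      simp only [Fin.sum_univ_three, cutWt, shL, shR, transferStep, Matrix.cons_val_zero,
        Matrix.cons_val_one, Matrix.cons_val, add_zero, ← sub_eq_add_neg]
      ring
    rw [transfer, ← h2, ← h1]
    refine Finset.sum_congr rfl fun c _ => ?_
    rw [Finset.mul_sum]
    refine Finset.sum_congr rfl fun e _ => ?_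
    set c' : Fin (n + 2) → Fin 3 := Fin.snocEquiv (fun _ => Fin 3) (e, c) with hc'
    have hc : ∀ i : Fin (n + 1), c' i.castSucc = c i := by
      intro i
      rw [hc', Fin.snocEquiv_apply, Fin.snoc_castSucc]
    have he : c' (Fin.last (n + 1)) = e := by
      rw [hc', Fin.snocEquiv_apply, Fin.snoc_last]
    have e1 : ∏ i, cutWt u v (c' i) = (∏ i, cutWt u v (c i)) * cutWt u v e := by
      rw [Fin.prod_univ_castSucc]
      simp only [hc, he]
    have e2 : ∏ i : Fin (n + 1),
          ind A (k i + shR (c' i.castSucc)) (k (i + 1) + shL (c' i.succ)) (l i) =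
        (∏ i : Fin n, ind A (k i + shR (c i.castSucc)) (k (i + 1) + shL (c i.succ)) (l i)) *
          ind A (k n + shR (c (Fin.last n))) (k (n + 1) + shL e) (l n) := by
      rw [Fin.prod_univ_castSucc]
      simp only [hc, he, Fin.succ_castSucc, Fin.succ_last, Fin.val_castSucc, Fin.val_last]
    rw [e1, e2, he]
    ring

theorem rowWt_eq_transfer {A : Type*} [CommRing A] (u v : A) (k l : ℕ → ℤ) (n : ℕ) :
    rowWt u v (fun i : Fin (n + 1) => k i) (fun i : Fin n => l i) =
      (transfer u v k l n).1 + (transfer u v k l n).2 := by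
  have := sum_eq_transfer u v k l n fun _ => 1
  simpa [rowWt] using this

theorem transferStep_of_lt_of_lt {A : Type*} [CommRing A] (u v : A) {kL kR l : ℤ} (h1 : kL < l)
    (h2 : l < kR) (s : A × A) :
    transferStep u v kL kR l s = ((s.1 + s.2) * v, (s.1 + s.2) * (1 - v)) := by
  simp only [transferStep, ind, h1.le, h2.not_gt, if_true, if_false,
    show kL + 1 ≤ l by omega, show ¬ kR - 1 < l by omega, sub_zero, mul_one]
  ext <;> simp <;> ring

theorem transferStep_left {A : Type*} [CommRing A] (u v : A) {kL kR : ℤ} (h : kL < kR)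
    (s : A × A) : transferStep u v kL kR kL s = (s.1 * v, s.1 * (1 - v)) := by
  simp only [transferStep, ind, le_refl, h.not_gt, if_true, if_false,
    show ¬ kL + 1 ≤ kL by omega, show ¬ kR - 1 < kL by omega, sub_zero, mul_one, mul_zero, add_zero]
  ext <;> simp <;> ring

theorem transferStep_right {A : Type*} [CommRing A] (u v : A) {kL kR : ℤ} (h : kL < kR)
    (s : A × A) : transferStep u v kL kR kR s = (0, (s.1 + s.2) * u) := by
  simp only [transferStep, ind, h.le, if_true, if_false, lt_irrefl,
    show kL + 1 ≤ kR by omega, show kR - 1 < kR by omega, sub_zero, mul_one]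
  ext
  · simp
  · simp only
    ring

theorem transferStep_eq {A : Type*} [CommRing A] (k : ℤ) (s : A × A) :
    transferStep 1 1 k k k s = (-s.2, s.1 + s.2) := by
  simp only [transferStep, ind, le_refl, if_true, if_false, lt_irrefl,
    show ¬ k + 1 ≤ k by omega, show k - 1 < k by omega]
  ext <;> simp

/-- The weight of the coincidences between the first `n` entries of `l` and the row `k`. -/
def coincWt {A : Type*} [CommRing A] (u v : A) (k l : ℕ → ℤ) (n : ℕ) : A :=
  ∏ i ∈ range n, (if l i = k i then v else 1) * (if l i = k (i + 1) then u else 1)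

theorem strict_succ_iff (l : ℕ → ℤ) (n : ℕ) :
    (∀ i, i + 1 < n + 1 → l i < l (i + 1)) ↔
      (∀ i, i + 1 < n → l i < l (i + 1)) ∧ ∀ i, i + 1 = n → l i < l n := by
  constructor
  · intro h
    refine ⟨fun i hi => h i (by omega), ?_⟩
    rintro i rfl
    exact h i (by omega)
  · rintro ⟨h1, h2⟩ i hi
    rcases Nat.lt_or_ge (i + 1) n with h | h
    · exact h1 i h
    · obtain rfl : i + 1 = n := by omega
      exact h2 i rfl

theorem transfer_of_strict {A : Type*} [CommRing A] (u v : A) (k l : ℕ → ℤ) (n : ℕ)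
    (hk : ∀ i < n, k i < k (i + 1)) (hl : ∀ i < n, k i ≤ l i ∧ l i ≤ k (i + 1)) :
    ((∀ i, i + 1 < n → l i < l (i + 1)) ∧ (∀ i, i + 1 = n → l i < k n) ∧
        transfer u v k l n = (coincWt u v k l n * v, coincWt u v k l n * (1 - v))) ∨
      ((∀ i, i + 1 < n → l i < l (i + 1)) ∧ (∃ i, i + 1 = n ∧ l i = k n) ∧
        transfer u v k l n = (0, coincWt u v k l n)) ∨
      (¬ (∀ i, i + 1 < n → l i < l (i + 1)) ∧ transfer u v k l n = (0, 0)) := by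
  induction n with
  | zero => exact Or.inl ⟨by simp, by simp, by simp [transfer, coincWt]⟩
  | succ n ih =>
    have ih := ih (fun i hi => hk i (by omega)) (fun i hi => hl i (by omega))
    have hkn := hk n (by omega)
    obtain ⟨hl1, hl2⟩ := hl n (by omega)
    have hX : coincWt u v k l (n + 1) = coincWt u v k l n *
      ((if l n = k n then v else 1) * (if l n = k (n + 1) then u else 1)) := by
      rw [coincWt, Finset.prod_range_succ, ← coincWt]
    rw [strict_succ_iff, transfer]
    rcases eq_or_lt_of_le hl1 with h1 | h1
    · have hX' : coincWt u v k l (n + 1) = coincWt u v k l n * v := by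
        rw [hX, if_pos h1.symm, if_neg (by omega), mul_one]
      rw [← h1, transferStep_left u v hkn, hX']
      rcases ih with ⟨hS, hlt, ht⟩ | ⟨hS, ⟨i, hi, hik⟩, ht⟩ | ⟨hS, ht⟩
      · refine Or.inl ⟨⟨hS, hlt⟩, ?_, ?_⟩
        · intro i hi
          obtain rfl : i = n := by omega
          omega
        · rw [ht]
      · refine Or.inr (Or.inr ⟨fun h => ?_, ?_⟩)
        · have := h.2 i hi
          omega
        · rw [ht]; simp
      · refine Or.inr (Or.inr ⟨fun h => hS h.1, ?_⟩)
        rw [ht]; simp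
    · have hS2 : ∀ i, i + 1 = n → l i < l n := by
        rintro i rfl
        have := hl i (by omega)
        omega
      have hsum : ((transfer u v k l n).1 + (transfer u v k l n).2 = coincWt u v k l n ∧
            ∀ i, i + 1 < n → l i < l (i + 1)) ∨
          ((transfer u v k l n).1 + (transfer u v k l n).2 = 0 ∧
            ¬ ∀ i, i + 1 < n → l i < l (i + 1)) := by
        rcases ih with ⟨hS, -, ht⟩ | ⟨hS, -, ht⟩ | ⟨hS, ht⟩
        · refine Or.inl ⟨?_, hS⟩; rw [ht]; ring
        · refine Or.inl ⟨?_, hS⟩; rw [ht]; ring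
        · refine Or.inr ⟨?_, hS⟩; rw [ht]; ring
      rcases eq_or_lt_of_le hl2 with h2 | h2
      · have hX' : coincWt u v k l (n + 1) = coincWt u v k l n * u := by
          rw [hX, if_pos h2, if_neg (by omega), one_mul]
        have hts := transferStep_right u v hkn (transfer u v k l n)
        rw [← h2] at hts
        rw [h2] at hts
        rcases hsum with ⟨hs, hS⟩ | ⟨hs, hS⟩
        · refine Or.inr (Or.inl ⟨⟨hS, hS2⟩, ⟨n, rfl, h2⟩, ?_⟩)
          rw [h2, hts, hs, hX']
        · refine Or.inr (Or.inr ⟨fun h => hS h.1, ?_⟩)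
          rw [h2, hts, hs]; simp
      · have hX' : coincWt u v k l (n + 1) = coincWt u v k l n := by
          rw [hX, if_neg (by omega), if_neg (by omega), one_mul, mul_one]
        rw [transferStep_of_lt_of_lt u v h1 h2, hX']
        rcases hsum with ⟨hs, hS⟩ | ⟨hs, hS⟩
        · refine Or.inl ⟨⟨hS, hS2⟩, ?_, ?_⟩
          · intro i hi
            obtain rfl : i = n := by omega
            exact h2
          · rw [hs]
        · refine Or.inr (Or.inr ⟨fun h => hS h.1, ?_⟩)
          rw [hs]; simp

theorem transfer_sum_of_strict {A : Type*} [CommRing A] (u v : A) (k l : ℕ → ℤ) (n : ℕ)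
    (hk : ∀ i < n, k i < k (i + 1)) (hl : ∀ i < n, k i ≤ l i ∧ l i ≤ k (i + 1)) :
    ((∀ i, i + 1 < n → l i < l (i + 1)) ∧
        (transfer u v k l n).1 + (transfer u v k l n).2 = coincWt u v k l n) ∨
      (¬ (∀ i, i + 1 < n → l i < l (i + 1)) ∧
        (transfer u v k l n).1 + (transfer u v k l n).2 = 0) := by
  rcases transfer_of_strict u v k l n hk hl with ⟨hS, -, ht⟩ | ⟨hS, -, ht⟩ | ⟨hS, ht⟩
  · refine Or.inl ⟨hS, ?_⟩; rw [ht]; ring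
  · refine Or.inl ⟨hS, ?_⟩; rw [ht]; ring
  · refine Or.inr ⟨hS, ?_⟩; rw [ht]; ring

theorem transfer_of_weak {A : Type*} [CommRing A] (k l : ℕ → ℤ) (n : ℕ)
    (hl : ∀ i < n, k i ≤ l i ∧ l i ≤ k (i + 1)) :
    (∃ i, i + 2 < n ∧ l i = l (i + 1) ∧ l (i + 1) = l (i + 2)) ∨
      ((∀ i, i + 1 < n → l i < l (i + 1)) ∧ (∀ i, i + 1 = n → l i < k n) ∧
        transfer (1 : A) 1 k l n = (1, 0)) ∨
      ((∀ i, i + 1 < n → l i < l (i + 1)) ∧ (∃ i, i + 1 = n ∧ l i = k n) ∧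
        transfer (1 : A) 1 k l n = (0, 1)) ∨
      (¬ (∀ i, i + 1 < n → l i < l (i + 1)) ∧ transfer (1 : A) 1 k l n = (0, 0)) ∨
      (¬ (∀ i, i + 1 < n → l i < l (i + 1)) ∧
        (∃ i, i + 2 = n ∧ l i = k n ∧ l (i + 1) = k n) ∧
        transfer (1 : A) 1 k l n = (-1, 1)) := by
  induction n with
  | zero => exact Or.inr (Or.inl ⟨by simp, by simp, by simp [transfer]⟩)
  | succ n ih =>
    have ih := ih (fun i hi => hl i (by omega))
    obtain ⟨hl1, hl2⟩ := hl n (by omega)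
    rw [strict_succ_iff, transfer]
    rcases ih with ⟨i, hi, h⟩ | ih
    · exact Or.inl ⟨i, by omega, h⟩
    have hlt : ∀ i, i + 1 = n → k n < l n → l i < l n := by
      rintro i rfl h
      have := (hl i (by omega)).2
      omega
    rcases eq_or_lt_of_le hl1 with h1 | h1
    · rcases eq_or_lt_of_le hl2 with h2 | h2
      · have hts := transferStep_eq (k n) (transfer (1 : A) 1 k l n)
        have hk2 : k (n + 1) = k n := by omega
        rw [hk2, ← h1, hts]
        rcases ih with ⟨hS, hk, ht⟩ | ⟨hS, ⟨i, hi, hik⟩, ht⟩ | ⟨hS, ht⟩ |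
          ⟨hS, ⟨i, hi, hik, hik2⟩, ht⟩
        · refine Or.inr (Or.inr (Or.inl ⟨⟨hS, hk⟩, ⟨n, rfl, h1.symm⟩, ?_⟩))
          rw [ht]; simp
        · refine Or.inr (Or.inr (Or.inr (Or.inr ⟨fun h => ?_, ⟨i, by omega, hik, ?_⟩, ?_⟩)))
          · have := h.2 i hi
            omega
          · rw [hi]; exact h1.symm
          · rw [ht]; simp
        · refine Or.inr (Or.inr (Or.inr (Or.inl ⟨fun h => hS h.1, ?_⟩)))
          rw [ht]; simp
        · refine Or.inl ⟨i, by omega, hik.trans hik2.symm, ?_⟩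
          rw [hi, hik2, h1]
      · rw [← h1, transferStep_left 1 1 (show k n < k (n + 1) by omega)]
        rcases ih with ⟨hS, hk, ht⟩ | ⟨hS, ⟨i, hi, hik⟩, ht⟩ | ⟨hS, ht⟩ |
          ⟨hS, ⟨i, hi, hik, hik2⟩, ht⟩
        · refine Or.inr (Or.inl ⟨⟨hS, hk⟩, ?_, ?_⟩)
          · intro i hi
            obtain rfl : i = n := by omega
            omega
          · rw [ht]; simp
        · refine Or.inr (Or.inr (Or.inr (Or.inl ⟨fun h => ?_, ?_⟩)))
          · have := h.2 i hi
            omega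
          · rw [ht]; simp
        · refine Or.inr (Or.inr (Or.inr (Or.inl ⟨fun h => hS h.1, ?_⟩)))
          rw [ht]; simp
        · refine Or.inl ⟨i, by omega, hik.trans hik2.symm, ?_⟩
          rw [hi, hik2, h1]
    · have hlt' : ∀ i, i + 1 = n → l i < l n := fun i hi => hlt i hi h1
      have hsum : ((transfer (1 : A) 1 k l n).1 + (transfer (1 : A) 1 k l n).2 = 1 ∧
            ∀ i, i + 1 < n → l i < l (i + 1)) ∨
          ((transfer (1 : A) 1 k l n).1 + (transfer (1 : A) 1 k l n).2 = 0 ∧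
            ¬ ∀ i, i + 1 < n → l i < l (i + 1)) := by
        rcases ih with ⟨hS, -, ht⟩ | ⟨hS, -, ht⟩ | ⟨hS, ht⟩ | ⟨hS, -, ht⟩
        · refine Or.inl ⟨?_, hS⟩; rw [ht]; ring
        · refine Or.inl ⟨?_, hS⟩; rw [ht]; ring
        · refine Or.inr ⟨?_, hS⟩; rw [ht]; ring
        · refine Or.inr ⟨?_, hS⟩; rw [ht]; ring
      rcases eq_or_lt_of_le hl2 with h2 | h2
      · rw [h2, transferStep_right 1 1 (show k n < k (n + 1) by omega), ← h2]
        rcases hsum with ⟨hs, hS⟩ | ⟨hs, hS⟩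
        · refine Or.inr (Or.inr (Or.inl ⟨⟨hS, hlt'⟩, ⟨n, rfl, rfl⟩, ?_⟩))
          rw [hs]; simp
        · refine Or.inr (Or.inr (Or.inr (Or.inl ⟨fun h => hS h.1, ?_⟩)))
          rw [hs]; simp
      · rw [transferStep_of_lt_of_lt 1 1 h1 h2]
        rcases hsum with ⟨hs, hS⟩ | ⟨hs, hS⟩
        · refine Or.inr (Or.inl ⟨⟨hS, hlt'⟩, ?_, ?_⟩)
          · intro i hi
            obtain rfl : i = n := by omega
            omega
          · rw [hs]; simp
        · refine Or.inr (Or.inr (Or.inr (Or.inl ⟨fun h => hS h.1, ?_⟩)))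
          rw [hs]; simp

theorem transfer_sum_of_weak {A : Type*} [CommRing A] (k l : ℕ → ℤ) (n : ℕ)
    (hl : ∀ i < n, k i ≤ l i ∧ l i ≤ k (i + 1)) :
    (∃ i, i + 2 < n ∧ l i = l (i + 1) ∧ l (i + 1) = l (i + 2)) ∨
    ((∀ i, i + 1 < n → l i < l (i + 1)) ∧
        (transfer (1 : A) 1 k l n).1 + (transfer (1 : A) 1 k l n).2 = 1) ∨
      (¬ (∀ i, i + 1 < n → l i < l (i + 1)) ∧
        (transfer (1 : A) 1 k l n).1 + (transfer (1 : A) 1 k l n).2 = 0) := by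
  rcases transfer_of_weak (A := A) k l n hl with
    hT | ⟨hS, -, ht⟩ | ⟨hS, -, ht⟩ | ⟨hS, ht⟩ | ⟨hS, -, ht⟩
  · exact Or.inl hT
  · refine Or.inr (Or.inl ⟨hS, ?_⟩); rw [ht]; ring
  · refine Or.inr (Or.inl ⟨hS, ?_⟩); rw [ht]; ring
  · refine Or.inr (Or.inr ⟨hS, ?_⟩); rw [ht]; ring
  · refine Or.inr (Or.inr ⟨hS, ?_⟩); rw [ht]; ring

/-- The monomials of the Laurent polynomial ring in `n` variables, as units. -/
noncomputable def monomialUnit (R : Type*) [CommRing R] (n : ℕ) :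
    Multiplicative (Fin n → ℤ) →* (AddMonoidAlgebra R (Fin n → ℤ))ˣ :=
  (Units.map (AddMonoidAlgebra.of R (Fin n → ℤ))).comp
    (toUnits : Multiplicative (Fin n → ℤ) ≃* _).toMonoidHom

theorem coe_monomialUnit {R : Type*} [CommRing R] {n : ℕ} (x : Fin n → ℤ) :
    (monomialUnit R n (Multiplicative.ofAdd x) : AddMonoidAlgebra R (Fin n → ℤ)) =
      AddMonoidAlgebra.single x 1 := by
  simp [monomialUnit]

/-- The `i`-th variable of the Laurent polynomial ring in `n` variables. -/
noncomputable def laurentVar (R : Type*) [CommRing R] {n : ℕ} (i : Fin n) :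
    (AddMonoidAlgebra R (Fin n → ℤ))ˣ :=
  monomialUnit R n (Multiplicative.ofAdd (Pi.single i 1))

theorem laurentVar_zpow {R : Type*} [CommRing R] {n : ℕ} (i : Fin n) (k : ℤ) :
    laurentVar R i ^ k = monomialUnit R n (Multiplicative.ofAdd (Pi.single i k)) := by
  rw [laurentVar, ← map_zpow, ← ofAdd_zsmul, ← Pi.single_smul]
  simp

theorem coe_prod_laurentVar_zpow {R : Type*} [CommRing R] {n : ℕ} (σ : Equiv.Perm (Fin n))
    (k : Fin n → ℤ) :
    ((∏ j, laurentVar R (σ j) ^ k j : (AddMonoidAlgebra R (Fin n → ℤ))ˣ) :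
      AddMonoidAlgebra R (Fin n → ℤ)) = AddMonoidAlgebra.single (k ∘ σ.symm) 1 := by
  simp only [laurentVar_zpow, ← map_prod, ← ofAdd_sum]
  rw [coe_monomialUnit]
  congr 1
  rw [← Equiv.sum_comp σ.symm]
  simp only [Equiv.apply_symm_apply]
  exact Finset.univ_sum_single (k ∘ σ.symm)

/-- The functional on Laurent polynomials sending the monomial with exponent `x` to
`∏ i, f i (x i)`. -/
noncomputable def monomialEval {R : Type*} [CommRing R] {n : ℕ} (f : Fin n → ℤ → R) :
    AddMonoidAlgebra R (Fin n → ℤ) →+ R :=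
  AddMonoidAlgebra.liftNC (AddMonoidHom.id R) fun x => ∏ i, f i (x.toAdd i)

theorem monomialEval_single {R : Type*} [CommRing R] {n : ℕ} (f : Fin n → ℤ → R)
    (x : Fin n → ℤ) (r : R) :
    monomialEval f (AddMonoidAlgebra.single x r) = r * ∏ i, f i (x i) := by
  simp [monomialEval]

theorem monomialEval_algebraMap_mul {R : Type*} [CommRing R] {n : ℕ} (f : Fin n → ℤ → R)
    (r : R) (p : AddMonoidAlgebra R (Fin n → ℤ)) :
    monomialEval f (algebraMap R _ r * p) = r * monomialEval f p := by
  induction p using AddMonoidAlgebra.induction_linear with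
  | zero => simp
  | add p q hp hq => rw [mul_add, map_add, hp, hq, map_add, mul_add]
  | single x s =>
    rw [AddMonoidAlgebra.coe_algebraMap]
    simp [AddMonoidAlgebra.single_mul_single, monomialEval_single, mul_assoc]

theorem monomialEval_laurentVar_sub_one_mul {R : Type*} [CommRing R] {n : ℕ}
    (f : Fin n → ℤ → R) (i : Fin n) (p : AddMonoidAlgebra R (Fin n → ℤ)) :
    monomialEval f (((laurentVar R i : AddMonoidAlgebra R (Fin n → ℤ)) - 1) * p) =
      monomialEval (Function.update f i fun x => f i (x + 1) - f i x) p := by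
  induction p using AddMonoidAlgebra.induction_linear with
  | zero => simp
  | add p q hp hq => rw [mul_add, map_add, hp, hq, map_add]
  | single x s =>
    rw [laurentVar, coe_monomialUnit, sub_mul, one_mul, map_sub,
      AddMonoidAlgebra.single_mul_single, one_mul]
    simp only [monomialEval_single]
    rw [← Finset.mul_prod_erase univ _ (mem_univ i),
      ← Finset.mul_prod_erase univ (fun j => f j (x j)) (mem_univ i),
      ← Finset.mul_prod_erase univ (fun j => Function.update f i _ j (x j)) (mem_univ i)]
    have h1 : ∏ j ∈ univ.erase i, f j ((Pi.single i 1 + x : Fin n → ℤ) j) =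
        ∏ j ∈ univ.erase i, f j (x j) :=
      Finset.prod_congr rfl fun j hj => by simp [Finset.ne_of_mem_erase hj]
    have h2 : ∏ j ∈ univ.erase i, Function.update f i (fun x => f i (x + 1) - f i x) j (x j) =
        ∏ j ∈ univ.erase i, f j (x j) :=
      Finset.prod_congr rfl fun j hj => by simp [Finset.ne_of_mem_erase hj]
    rw [h1, h2]
    simp only [Pi.add_apply, Pi.single_eq_same, Function.update_self, add_comm (1 : ℤ)]
    ring

theorem monomialEval_prod_laurentVar_sub_one_mul {R : Type*} [CommRing R] {n : ℕ}
    (f g : Fin n → ℤ → R) (hfg : ∀ i x, f i (x + 1) - f i x = g i x)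
    (p : AddMonoidAlgebra R (Fin n → ℤ)) :
    monomialEval f ((∏ i : Fin n, ((laurentVar R i : AddMonoidAlgebra R (Fin n → ℤ)) - 1)) * p) =
      monomialEval g p := by
  suffices h : ∀ s : Finset (Fin n), monomialEval f
      ((∏ i ∈ s, ((laurentVar R i : AddMonoidAlgebra R (Fin n → ℤ)) - 1)) * p) =
        monomialEval (fun i => if i ∈ s then g i else f i) p by
    simpa using h univ
  intro s
  induction s using Finset.induction_on generalizing p with
  | empty => simp
  | insert i s hi ih =>
    rw [Finset.prod_insert hi, mul_comm (_ - 1), mul_assoc, ih, monomialEval_laurentVar_sub_one_mul]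
    congr 2
    funext j x
    rcases eq_or_ne j i with rfl | hj
    · simp [hi, hfg]
    · simp [hj]

/-- The binomial coefficient `x choose k` as an element of `R`. -/
noncomputable def chooseIn (R : Type*) [CommRing R] (k : ℕ) (x : ℤ) : R :=
  ((Ring.choose x k : ℤ) : R)

theorem chooseIn_sub (R : Type*) [CommRing R] (k : ℕ) (x : ℤ) :
    chooseIn R (k + 1) (x + 1) - chooseIn R (k + 1) x = chooseIn R k x := by
  rw [chooseIn, Ring.choose_succ_succ]
  simp [chooseIn]

/-- The homomorphism setting the zeroth Laurent variable to one. -/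
noncomputable def dropVar (R : Type*) [CommRing R] (n : ℕ) :
    AddMonoidAlgebra R (Fin (n + 1) → ℤ) →+* AddMonoidAlgebra R (Fin n → ℤ) :=
  AddMonoidAlgebra.mapDomainRingHom R
    ({ toFun := fun x => Fin.tail x, map_zero' := rfl, map_add' := fun _ _ => rfl } :
      (Fin (n + 1) → ℤ) →+ (Fin n → ℤ))

theorem dropVar_single {R : Type*} [CommRing R] {n : ℕ} (x : Fin (n + 1) → ℤ) (r : R) :
    dropVar R n (AddMonoidAlgebra.single x r) = AddMonoidAlgebra.single (Fin.tail x) r := by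
  simp [dropVar]
  rfl

theorem monomialEval_chooseIn_succ {R : Type*} [CommRing R] {n : ℕ}
    (p : AddMonoidAlgebra R (Fin (n + 1) → ℤ)) :
    monomialEval (fun i : Fin (n + 1) => chooseIn R i) p =
      monomialEval (fun i : Fin n => chooseIn R (i + 1)) (dropVar R n p) := by
  induction p using AddMonoidAlgebra.induction_linear with
  | zero => simp
  | add p q hp hq => rw [map_add, hp, hq, map_add, map_add]
  | single x s =>
    rw [dropVar_single, monomialEval_single, monomialEval_single, Fin.prod_univ_succ]
    simp [chooseIn, Fin.tail]

theorem map_laurentVar {R : Type*} [CommRing R] {n : ℕ} :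
    (fun i : Fin (n + 1) => Units.map (dropVar R n : _ →* _) (laurentVar R i)) =
      Fin.cons 1 fun i : Fin n => laurentVar R i := by
  funext i
  refine Fin.cases ?_ (fun i => ?_) i
  · ext : 1
    simp only [Units.coe_map, Fin.cons_zero, laurentVar, coe_monomialUnit, MonoidHom.coe_coe,
      dropVar_single, Units.val_one, AddMonoidAlgebra.one_def]
    congr 1
  · ext : 1
    simp only [Units.coe_map, Fin.cons_succ, laurentVar, coe_monomialUnit, MonoidHom.coe_coe,
      dropVar_single]
    congr 1
    funext j
    simp [Fin.tail, Pi.single_apply]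

theorem map_symb {A B : Type*} [CommRing A] [CommRing B] (φ : A →+* B) (u v : A) (x y : Aˣ) :
    φ (symb u v x y) = symb (φ u) (φ v) (Units.map (φ : A →* B) x) (Units.map (φ : A →* B) y) := by
  have h2 : ∀ w : Aˣ, φ (w : A) = (Units.map (φ : A →* B) w : B) := fun _ => rfl
  simp only [symb, map_sum, map_mul φ, map_cutWt, h2, map_mul (Units.map (φ : A →* B)), map_zpow]

theorem map_bethe {A B : Type*} [CommRing A] [CommRing B] (φ : A →+* B) (u v : A) {n : ℕ}
    (k : Fin n → ℤ) (z : Fin n → Aˣ) :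
    φ (bethe u v k z) = bethe (φ u) (φ v) k fun i => Units.map (φ : A →* B) (z i) := by
  have h2 : ∀ w : Aˣ, φ (w : A) = (Units.map (φ : A →* B) w : B) := fun _ => rfl
  simp only [bethe, alt, map_sum, map_mul φ, map_intCast, symbProd, map_prod φ, apply_ite φ,
    map_one φ, map_symb, Function.comp_apply, h2, map_prod (Units.map (φ : A →* B)), map_zpow]

/-- The value at `b 1, …, b n` of the operator formula, for parameters in an arbitrary ring. -/
noncomputable def opFormula {R : Type*} [CommRing R] (u v : R) (n : ℕ) (b : ℕ → ℤ) : R :=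
  monomialEval (fun i : Fin n => chooseIn R i)
    (bethe (algebraMap R _ u) (algebraMap R _ v) (fun j : Fin n => b (j + 1)) (laurentVar R))

/-- The sequence with entries `l 0, …, l (n - 1)` in positions `1, …, n`. -/
def extendRow {n : ℕ} (l : Fin n → ℤ) (j : ℕ) : ℤ :=
  if h : j - 1 < n then l ⟨j - 1, h⟩ else 0

theorem extendRow_succ {n : ℕ} (l : Fin n → ℤ) (j : Fin n) : extendRow l (j + 1) = l j := by
  simp [extendRow]

theorem opFormula_zero {R : Type*} [CommRing R] (u v : R) (b : ℕ → ℤ) :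
    opFormula u v 0 b = 1 := by
  simp [opFormula, bethe, alt, symbProd, AddMonoidAlgebra.one_def, monomialEval_single]

theorem opFormula_succ {R : Type*} [CommRing R] (u v : R) (n : ℕ) (b : ℕ → ℤ)
    (hb : ∀ i, 1 ≤ i → i < n + 1 → b i ≤ b (i + 1)) :
    opFormula u v (n + 1) b =
      ∑ l ∈ Fintype.piFinset fun i : Fin n => Icc (b (i + 1)) (b (i + 2)),
        rowWt u v (fun j : Fin (n + 1) => b (j + 1)) l * opFormula u v n (extendRow l) := by
  have hk : ∀ i : Fin n, (fun j : Fin (n + 1) => b (j + 1)) i.castSucc ≤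
      (fun j : Fin (n + 1) => b (j + 1)) i.succ := fun i => by
    simpa using hb (i + 1) (by omega) (by omega)
  have key := sum_rowWt_mul_bethe (algebraMap R (AddMonoidAlgebra R (Fin n → ℤ)) u)
    (algebraMap R _ v) (fun j : Fin (n + 1) => b (j + 1)) hk (laurentVar R)
  have hd : ∀ r : R, dropVar R n (algebraMap R _ r) = algebraMap R _ r := by
    intro r
    simp only [AddMonoidAlgebra.coe_algebraMap, Function.comp_apply, dropVar_single]
    rfl
  rw [opFormula, monomialEval_chooseIn_succ, map_bethe, map_laurentVar, hd, hd, ← key, mul_comm,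
    monomialEval_prod_laurentVar_sub_one_mul _ (fun i : Fin n => chooseIn R i)
      (fun i x => chooseIn_sub R i x), map_sum]
  refine Finset.sum_congr rfl fun l _ => ?_
  rw [← map_rowWt (algebraMap R (AddMonoidAlgebra R (Fin n → ℤ))), monomialEval_algebraMap_mul,
    opFormula]
  simp only [extendRow_succ]

theorem eval_substAdd (b : ℕ → ℤ) (a : ℕ) (c : ℤ) (f : MvPolynomial ℕ S2) :
    MvPolynomial.eval (fun i => ((b i : ℤ) : S2)) (substAdd a c f) =
      MvPolynomial.eval (fun i => (((b + Pi.single a c : ℕ → ℤ) i : ℤ) : S2)) f := by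
  have : (MvPolynomial.eval (fun i => ((b i : ℤ) : S2))).comp (substAdd a c) =
      MvPolynomial.eval (fun i => (((b + Pi.single a c : ℕ → ℤ) i : ℤ) : S2)) := by
    refine MvPolynomial.ringHom_ext (fun r => ?_) (fun i => ?_)
    · simp [substAdd]
    · rcases eq_or_ne i a with rfl | h
      · simp [substAdd]
      · simp [substAdd, h]
  exact congrArg (fun g : MvPolynomial ℕ S2 →+* S2 => g f) this

theorem eval_strictOp (b : ℕ → ℤ) (x y : ℕ) (f : MvPolynomial ℕ S2) :
    MvPolynomial.eval (fun i => ((b i : ℤ) : S2)) (StrictOp x y f) =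
      ∑ c : Fin 3, cutWt Uv Vv c * MvPolynomial.eval
        (fun i => (((b + Pi.single x (shL c) + Pi.single y (shR c) : ℕ → ℤ) i : ℤ) : S2)) f := by
  simp only [StrictOp, map_add, map_mul, MvPolynomial.eval_C, eval_substAdd, Fin.sum_univ_three]
  simp [cutWt, shL, shR]

theorem prod_Icc_one_eq_prod_fin {M : Type*} [CommMonoid M] (n : ℕ) (f : ℕ → M) :
    ∏ p ∈ Icc 1 n, f p = ∏ i : Fin n, f (i + 1) := by
  rw [Fin.prod_univ_eq_prod_range (fun i => f (i + 1)) n,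
    show Icc 1 n = Ico 1 (n + 1) from rfl, Finset.prod_Ico_eq_prod_range]
  simp [add_comm]

theorem prod_lt_pairs {M : Type*} [CommMonoid M] (n : ℕ) (f : ℕ × ℕ → M) :
    ∏ p ∈ (Icc 1 n ×ˢ Icc 1 n).filter (fun p => p.1 < p.2), f p =
      ∏ i : Fin n, ∏ j : Fin n, if i < j then f (i + 1, j + 1) else 1 := by
  rw [Finset.prod_filter, Finset.prod_product, prod_Icc_one_eq_prod_fin]
  refine Finset.prod_congr rfl fun i _ => ?_
  rw [prod_Icc_one_eq_prod_fin]
  refine Finset.prod_congr rfl fun j _ => ?_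
  simp

theorem prod_map_strictPairs {M : Type*} [CommMonoid M] (n : ℕ) (f : ℕ × ℕ → M) :
    ((strictPairs n).map f).prod =
      ∏ i : Fin n, ∏ j : Fin n, if i < j then f (i + 1, j + 1) else 1 := by
  have hnd : (strictPairs n).Nodup :=
    ((List.nodup_range' (s := 1) (n := n)).product (List.nodup_range' (s := 1) (n := n))).filter _
  rw [← List.prod_toFinset f hnd, ← prod_lt_pairs]
  refine Finset.prod_congr ?_ fun _ _ => rfl
  ext ⟨p, q⟩
  simp [strictPairs, List.mem_range'_1]
  omega

/-- The linear functional underlying `opFormula`. -/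
noncomputable def altEval (R : Type*) [CommRing R] (n : ℕ)
    (G : (Fin n → (AddMonoidAlgebra R (Fin n → ℤ))ˣ) → AddMonoidAlgebra R (Fin n → ℤ)) : R :=
  monomialEval (fun i : Fin n => chooseIn R i) (alt G (laurentVar R))

theorem alt_sum_mul {n : ℕ} {X A ι : Type*} [CommRing A] (s : Finset ι) (r : ι → A)
    (G : ι → (Fin n → X) → A) (z : Fin n → X) :
    alt (fun y => ∑ c ∈ s, r c * G c y) z = ∑ c ∈ s, r c * alt (G c) z := by
  simp only [alt, Finset.mul_sum]
  rw [Finset.sum_comm]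
  refine Finset.sum_congr rfl fun c _ => Finset.sum_congr rfl fun σ _ => ?_
  ring

theorem altEval_sum_algebraMap_mul {R : Type*} [CommRing R] {n : ℕ} {ι : Type*} (s : Finset ι)
    (r : ι → R)
    (G : ι → (Fin n → (AddMonoidAlgebra R (Fin n → ℤ))ˣ) → AddMonoidAlgebra R (Fin n → ℤ)) :
    altEval R n (fun y => ∑ c ∈ s, algebraMap R _ (r c) * G c y) =
      ∑ c ∈ s, r c * altEval R n (G c) := by
  rw [altEval, alt_sum_mul s (fun c => algebraMap R _ (r c)), map_sum]
  exact Finset.sum_congr rfl fun c _ => monomialEval_algebraMap_mul _ _ _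

theorem eval_strictOp_eq_altEval {n : ℕ} (i j : Fin n) (f : MvPolynomial ℕ S2)
    (H : (Fin n → (AddMonoidAlgebra S2 (Fin n → ℤ))ˣ) → AddMonoidAlgebra S2 (Fin n → ℤ))
    (hf : ∀ b : ℕ → ℤ, MvPolynomial.eval (fun i => ((b i : ℤ) : S2)) f =
      altEval S2 n fun y => H y * ↑(∏ j, y j ^ (b (j + 1) + (j : ℤ)))) (b : ℕ → ℤ) :
    MvPolynomial.eval (fun i => ((b i : ℤ) : S2)) (StrictOp (j + 1) (i + 1) f) =
      altEval S2 n fun y => symb (algebraMap S2 _ Uv) (algebraMap S2 _ Vv) (y j) (y i) * H y *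
        ↑(∏ j, y j ^ (b (j + 1) + (j : ℤ))) := by
  rw [eval_strictOp]
  simp only [hf]
  rw [← altEval_sum_algebraMap_mul]
  refine congrArg (altEval S2 n) (funext fun y => ?_)
  rw [symb, Finset.sum_mul, Finset.sum_mul]
  refine Finset.sum_congr rfl fun c _ => ?_
  have h : ∀ (a : Fin n) (d : ℤ),
      ∏ m, y m ^ (Pi.single ((a : ℕ) + 1) d : ℕ → ℤ) ((m : ℕ) + 1) = y a ^ d := by
    intro a d
    rw [Finset.prod_eq_single a]
    · simp
    · intro m _ hm
      rw [Pi.single_eq_of_ne, zpow_zero]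
      intro h
      exact hm (Fin.ext (by omega))
    · simp
  have h2 : ∏ m, y m ^ ((b + Pi.single ((j : ℕ) + 1) (shL c) + Pi.single ((i : ℕ) + 1) (shR c) :
      ℕ → ℤ) ((m : ℕ) + 1) + (m : ℤ)) =
      (y j ^ shL c * y i ^ shR c) * ∏ m, y m ^ (b (m + 1) + (m : ℤ)) := by
    rw [← h j, ← h i, ← Finset.prod_mul_distrib, ← Finset.prod_mul_distrib]
    refine Finset.prod_congr rfl fun m _ => ?_
    rw [← zpow_add, ← zpow_add]
    congr 1
    simp only [Pi.add_apply]
    ring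
  rw [h2, map_cutWt (algebraMap S2 _), Units.val_mul]
  ring

/-- The `p`-th entry of a one-based family of units, and one outside the range. -/
def entry {A : Type*} [CommRing A] {n : ℕ} (y : Fin n → Aˣ) (p : ℕ) : Aˣ :=
  if h : p - 1 < n then y ⟨p - 1, h⟩ else 1

theorem entry_succ {A : Type*} [CommRing A] {n : ℕ} (y : Fin n → Aˣ) (i : Fin n) :
    entry y (i + 1) = y i := by
  simp [entry]

theorem eval_foldr_strictOp {n : ℕ} (f : MvPolynomial ℕ S2)
    (hf : ∀ b : ℕ → ℤ, MvPolynomial.eval (fun i => ((b i : ℤ) : S2)) f =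
      altEval S2 n fun y => ↑(∏ j, y j ^ (b (j + 1) + (j : ℤ)))) (ps : List (ℕ × ℕ))
    (hps : ∀ pq ∈ ps, (1 ≤ pq.1 ∧ pq.1 ≤ n) ∧ 1 ≤ pq.2 ∧ pq.2 ≤ n) (b : ℕ → ℤ) :
    MvPolynomial.eval (fun i => ((b i : ℤ) : S2))
        (ps.foldr (fun pq g => StrictOp pq.2 pq.1 g) f) =
      altEval S2 n fun y => (ps.map fun pq => symb (algebraMap S2 _ Uv) (algebraMap S2 _ Vv)
        (entry y pq.2) (entry y pq.1)).prod * ↑(∏ j, y j ^ (b (j + 1) + (j : ℤ))) := by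
  induction ps generalizing b with
  | nil => simpa using hf b
  | cons pq ps ih =>
    obtain ⟨⟨hp1, hp2⟩, hq1, hq2⟩ := hps pq (by simp)
    have ih := ih fun pq h => hps pq (by simp [h])
    have key := eval_strictOp_eq_altEval ⟨pq.1 - 1, by omega⟩ ⟨pq.2 - 1, by omega⟩ _ _ ih b
    simp only [Nat.sub_add_cancel hp1, Nat.sub_add_cancel hq1] at key
    rw [List.foldr_cons, key]
    simp only [List.map_cons, List.prod_cons]
    refine congrArg (altEval S2 n) (funext fun y => ?_)
    simp only [entry, show pq.1 - 1 < n by omega, show pq.2 - 1 < n by omega, dif_pos]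

theorem prod_lt_sub_eq_det_choose {n : ℕ} (x : Fin n → ℤ) :
    ∏ i : Fin n, ∏ j : Fin n, (if i < j then x j - x i else 1) =
      (∏ i : Fin n, ((i : ℕ).factorial : ℤ)) *
        (Matrix.of fun i j : Fin n => Ring.choose (x i) (j : ℕ)).det := by
  have h1 : ∏ i : Fin n, ∏ j : Fin n, (if i < j then x j - x i else 1) =
      (Matrix.vandermonde x).det := by
    rw [Matrix.det_vandermonde]
    refine Finset.prod_congr rfl fun i _ => ?_
    rw [← Finset.prod_filter]
    refine Finset.prod_congr ?_ fun _ _ => rfl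
    ext j
    simp
  rw [h1, Matrix.det_eval_matrixOfPolynomials_eq_det_vandermonde x
    (fun j => descPochhammer ℤ j) (fun i => descPochhammer_natDegree ℤ i)
    (fun i => monic_descPochhammer ℤ i), ← Matrix.det_mul_row]
  congr 1
  ext i j
  have := Ring.descPochhammer_eq_factorial_smul_choose (x i) j
  rw [← Polynomial.eval_eq_smeval] at this
  simpa using this

theorem prod_lt_sub_eq_prod_factorial (n : ℕ) :
    ∏ i : Fin n, ∏ j : Fin n, (if i < j then (j : ℤ) - (i : ℤ) else 1) =
      ∏ i : Fin n, ((i : ℕ).factorial : ℤ) := by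
  rw [prod_lt_sub_eq_det_choose fun i : Fin n => (i : ℤ), Matrix.det_of_isLowerTriangular]
  · simp [Ring.choose_natCast]
  · intro i j hij
    have hij : i < j := by simpa using hij
    simp [Ring.choose_natCast, Nat.choose_eq_zero_of_lt hij]

theorem altEval_prod_zpow {R : Type*} [CommRing R] {n : ℕ} (x : Fin n → ℤ) :
    altEval R n (fun y => ↑(∏ j, y j ^ x j)) =
      ((Matrix.of fun i j : Fin n => Ring.choose (x i) (j : ℕ)).det : ℤ) := by
  rw [altEval, alt, map_sum, Matrix.det_apply', Int.cast_sum, ← Equiv.sum_comp (Equiv.inv _)]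
  refine Finset.sum_congr rfl fun σ _ => ?_
  have h := coe_prod_laurentVar_zpow (R := R) σ⁻¹ x
  simp only [Function.comp_apply, Equiv.inv_apply]
  rw [h, ← map_intCast (algebraMap R (AddMonoidAlgebra R (Fin n → ℤ))),
    monomialEval_algebraMap_mul, monomialEval_single]
  simp [chooseIn, ← Equiv.Perm.inv_def]

theorem eval_GTpoly (n : ℕ) (b : ℕ → ℤ) :
    MvPolynomial.eval (fun i => ((b i : ℤ) : S2)) (GTpoly n) =
      altEval S2 n fun y => ↑(∏ j, y j ^ (b (j + 1) + (j : ℤ))) := by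
  rw [altEval_prod_zpow fun j : Fin n => b (j + 1) + (j : ℤ), GTpoly, map_prod, prod_lt_pairs]
  have h : ∀ i j : Fin n, (if i < j then MvPolynomial.eval (fun i => ((b i : ℤ) : S2))
      (MvPolynomial.C (algebraMap ℚ S2 ((((j + 1 : ℕ) : ℚ) - ((i + 1 : ℕ) : ℚ))⁻¹)) *
      (MvPolynomial.X ((j : ℕ) + 1) - MvPolynomial.X ((i : ℕ) + 1) +
        MvPolynomial.C (((((j + 1 : ℕ) : ℤ) - ((i + 1 : ℕ) : ℤ)) : ℤ) : S2))) else 1) =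
      algebraMap ℚ S2 (((if i < j then (j : ℤ) - (i : ℤ) else 1 : ℤ) : ℚ)⁻¹ *
        ((if i < j then (b (j + 1) + (j : ℤ)) - (b (i + 1) + (i : ℤ)) else 1 : ℤ) : ℚ)) := by
    intro i j
    split_ifs
    · rw [map_mul, map_mul, MvPolynomial.eval_C]
      congr 1
      · push_cast; congr 1; ring
      · rw [map_intCast]; simp; ring
    · simp
  simp only [h, ← map_prod, Finset.prod_mul_distrib, Finset.prod_inv_distrib, ← Int.cast_prod]
  rw [prod_lt_sub_eq_prod_factorial,
    prod_lt_sub_eq_det_choose fun i : Fin n => b (i + 1) + (i : ℤ), Int.cast_mul,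
    inv_mul_cancel_left₀, map_intCast]
  exact_mod_cast Finset.prod_ne_zero_iff.2 fun i _ => Nat.factorial_ne_zero _

theorem eval_Mpoly (n : ℕ) (b : ℕ → ℤ) :
    MvPolynomial.eval (fun i => ((b i : ℤ) : S2)) (Mpoly n) = opFormula Uv Vv n b := by
  rw [Mpoly, eval_foldr_strictOp (GTpoly n) (eval_GTpoly n), opFormula, bethe, altEval]
  · simp only [prod_map_strictPairs, entry_succ]
    rfl
  · rintro ⟨p, q⟩ h
    simp [strictPairs, List.mem_range'_1] at h
    omega

/-- The array obtained from `M` by replacing row `n + 1` by `b 1, …, b (n + 1)`. -/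
def extendTri (n : ℕ) (b : ℕ → ℤ) (M : ℕ → ℕ → ℤ) : ℕ → ℕ → ℤ := fun i j =>
  if i = n + 1 then (if 1 ≤ j ∧ j ≤ n + 1 then b j else 0) else M i j

open Classical in
/-- The monotone triangles of order `n` with bottom row `b 1, …, b n`. -/
noncomputable def mtFinset : ℕ → (ℕ → ℤ) → Finset (ℕ → ℕ → ℤ)
  | 0, _ => {0}
  | n + 1, b =>
    ((Fintype.piFinset fun i : Fin n => Icc (b (i + 1)) (b (i + 2))).filter fun l =>
      ∀ i, i + 1 < n → extendRow l (i + 1) < extendRow l (i + 1 + 1)).biUnion fun l =>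
        (mtFinset n (extendRow l)).image (extendTri n b)

theorem mem_box_iff {n : ℕ} (b : ℕ → ℤ) (l : Fin n → ℤ) :
    (l ∈ Fintype.piFinset fun i : Fin n => Icc (b (i + 1)) (b (i + 2))) ↔
      ∀ i < n, b (i + 1) ≤ extendRow l (i + 1) ∧ extendRow l (i + 1) ≤ b (i + 1 + 1) := by
  simp only [Fintype.mem_piFinset, mem_Icc]
  constructor
  · intro h i hi
    rw [show extendRow l (i + 1) = l ⟨i, hi⟩ from extendRow_succ l ⟨i, hi⟩]
    exact h ⟨i, hi⟩
  · intro h i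
    rw [← extendRow_succ l i]
    exact h i i.2

theorem mem_mtFinset {n : ℕ} {b : ℕ → ℤ} {M : ℕ → ℕ → ℤ} :
    M ∈ mtFinset n b ↔ IsMT n M ∧ ∀ j ∈ Icc 1 n, M n j = b j := by
  induction n generalizing b M with
  | zero =>
    simp only [mtFinset, mem_singleton]
    constructor
    · rintro rfl
      exact ⟨⟨by simp, by simp, by simp⟩, by simp⟩
    · rintro ⟨⟨-, -, h⟩, -⟩
      funext i j
      exact h i j (by omega)
  | succ n ih =>
    simp only [mtFinset, mem_biUnion, mem_filter, mem_image, mem_box_iff, ih]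
    constructor
    · rintro ⟨l, ⟨hl, hs⟩, M', ⟨⟨h1, h2, h3⟩, h4⟩, rfl⟩
      refine ⟨⟨?_, ?_, ?_⟩, ?_⟩
      · intro i j hj hji hi
        rcases Nat.lt_or_ge i n with h | h
        · simpa [extendTri, h.ne, show i ≠ n + 1 by omega] using h1 i j hj hji h
        · obtain rfl : i = n := by omega
          obtain ⟨j, rfl⟩ : ∃ j', j = j' + 1 := ⟨j - 1, by omega⟩
          have := hl j (by omega)
          rw [← h4 (j + 1) (by simp; omega)] at this
          simpa [extendTri, show j ≤ i by omega, show j + 1 ≤ i by omega] using this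
      · intro i j hj hji hi
        rcases Nat.lt_or_ge i n with h | h
        · simpa [extendTri, show i ≠ n + 1 by omega] using h2 i j hj hji h
        · obtain rfl : i = n := by omega
          obtain ⟨j, rfl⟩ : ∃ j', j = j' + 1 := ⟨j - 1, by omega⟩
          have := hs j (by omega)
          rw [← h4 (j + 1) (by simp; omega), ← h4 (j + 1 + 1) (by simp; omega)] at this
          simpa [extendTri] using this
      · intro i j hij
        simp only [extendTri]
        split_ifs
        · omega
        · rfl
        · exact h3 i j (by omega)
      · intro j hj
        simp only [mem_Icc] at hj
        simp [extendTri, hj]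
    · rintro ⟨⟨h1, h2, h3⟩, h4⟩
      have he : ∀ i < n, extendRow (fun i : Fin n => M n (i + 1)) (i + 1) = M n (i + 1) :=
        fun i hi => extendRow_succ (fun i : Fin n => M n (i + 1)) ⟨i, hi⟩
      refine ⟨fun i : Fin n => M n (i + 1), ⟨fun i hi => ?_, fun i hi => ?_⟩,
        fun i j => if i = n + 1 then 0 else M i j, ⟨⟨?_, ?_, ?_⟩, ?_⟩, ?_⟩
      · rw [he i hi, ← h4 (i + 1) (by simp; omega), ← h4 (i + 1 + 1) (by simp; omega)]
        exact h1 n (i + 1) (by omega) (by omega) (by omega)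
      · rw [he i (by omega), he (i + 1) (by omega)]
        exact h2 n (i + 1) (by omega) (by omega) (by omega)
      · intro i j hj hji hi
        simpa [hi.ne, show i ≠ n + 1 by omega] using h1 i j hj hji (by omega)
      · intro i j hj hji hi
        simpa [show i ≠ n + 1 by omega] using h2 i j hj hji (by omega)
      · intro i j hij
        dsimp only
        split_ifs
        · rfl
        · exact h3 i j (by omega)
      · intro j hj
        simp only [mem_Icc] at hj
        obtain ⟨j, rfl⟩ : ∃ j', j = j' + 1 := ⟨j - 1, by omega⟩
        rw [he j (by omega)]
        simp
      · funext i j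
        simp only [extendTri]
        split_ifs with hi hj
        · rw [hi, h4 j (by simpa using hj)]
        · exact (h3 i j (by omega)).symm
        · rfl

theorem mtFinset_eq_empty {n : ℕ} {b : ℕ → ℤ} {i : ℕ} (hi : 1 ≤ i) (hin : i + 2 ≤ n)
    (h1 : b i = b (i + 1)) (h2 : b (i + 1) = b (i + 2)) : mtFinset n b = ∅ := by
  refine Finset.eq_empty_of_forall_notMem fun M hM => ?_
  obtain ⟨⟨hM1, hM2, -⟩, hb⟩ := mem_mtFinset.1 hM
  obtain ⟨m, rfl⟩ : ∃ m, n = m + 1 := ⟨n - 1, by omega⟩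
  change b (i + 1) = b (i + 1 + 1) at h2
  have e1 := hM1 m i hi (by omega) (by omega)
  have e2 := hM1 m (i + 1) (by omega) (by omega) (by omega)
  have e3 := hM2 m i hi (by omega) (by omega)
  rw [hb i (by simp; omega), hb (i + 1) (by simp; omega)] at e1
  rw [hb (i + 1) (by simp; omega), hb (i + 1 + 1) (by simp; omega)] at e2
  omega

theorem card_filter_extendTri {n d : ℕ} (hd : d ≤ 1) (b : ℕ → ℤ) (M : ℕ → ℕ → ℤ) :
    (((Icc 1 (n + 1)) ×ˢ (Icc 1 (n + 1))).filter (fun p => p.2 ≤ p.1 ∧ p.1 < n + 1 ∧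
      extendTri n b M p.1 p.2 = extendTri n b M (p.1 + 1) (p.2 + d))).card =
      (((Icc 1 n) ×ˢ (Icc 1 n)).filter
        fun p => p.2 ≤ p.1 ∧ p.1 < n ∧ M p.1 p.2 = M (p.1 + 1) (p.2 + d)).card +
      ((range n).filter fun i => M n (i + 1) = b (i + 1 + d)).card := by
  have : ((Icc 1 (n + 1)) ×ˢ (Icc 1 (n + 1))).filter (fun p => p.2 ≤ p.1 ∧ p.1 < n + 1 ∧
      extendTri n b M p.1 p.2 = extendTri n b M (p.1 + 1) (p.2 + d)) =
      (((Icc 1 n) ×ˢ (Icc 1 n)).filter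
        fun p => p.2 ≤ p.1 ∧ p.1 < n ∧ M p.1 p.2 = M (p.1 + 1) (p.2 + d)) ∪
      ((range n).filter fun i => M n (i + 1) = b (i + 1 + d)).image fun i => (n, i + 1) := by
    ext ⟨i, j⟩
    rw [mem_filter, mem_union, mem_filter, mem_image]
    simp only [mem_filter, mem_product, mem_Icc, mem_range, Prod.mk.injEq]
    rcases lt_trichotomy i n with h | rfl | h
    · simp only [extendTri, show i ≠ n + 1 by omega, if_false, show i + 1 ≠ n + 1 by omega]
      constructor
      · rintro ⟨hij, hji, hin, hM⟩
        exact Or.inl ⟨by omega, hji, h, hM⟩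
      · rintro (⟨hij, hji, hin, hM⟩ | ⟨a, ha, rfl, rfl⟩)
        · exact ⟨by omega, hji, by omega, hM⟩
        · omega
    · simp only [extendTri, show i ≠ i + 1 by omega, if_false, if_true]
      constructor
      · rintro ⟨hij, hji, hin, hM⟩
        rw [if_pos (by omega)] at hM
        exact Or.inr ⟨j - 1, ⟨by omega, by rw [Nat.sub_add_cancel hij.2.1]; exact hM⟩, trivial,
          Nat.sub_add_cancel hij.2.1⟩
      · rintro (⟨hij, hji, hin, hM⟩ | ⟨a, ⟨ha, hM⟩, -, rfl⟩)
        · omega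
        · exact ⟨by omega, by omega, by omega, by rw [if_pos (by omega)]; exact hM⟩
    · constructor
      · omega
      · rintro (h | ⟨a, ha, rfl, rfl⟩)
        · omega
        · exact absurd h (lt_irrefl _)
  rw [this, Finset.card_union_of_disjoint, Finset.card_image_of_injective]
  · intro i j h
    simpa using h
  · rw [Finset.disjoint_left]
    rintro ⟨i, j⟩ h h'
    simp only [mem_filter, mem_image, Prod.mk.injEq] at h h'
    obtain ⟨a, -, rfl, -⟩ := h'
    omega

theorem invMT_extendTri {n : ℕ} (b : ℕ → ℤ) (M : ℕ → ℕ → ℤ) :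
    invMT (n + 1) (extendTri n b M) =
      invMT n M + ((range n).filter fun i => M n (i + 1) = b (i + 1 + 1)).card :=
  card_filter_extendTri le_rfl b M

theorem invMT'_extendTri {n : ℕ} (b : ℕ → ℤ) (M : ℕ → ℕ → ℤ) :
    invMT' (n + 1) (extendTri n b M) =
      invMT' n M + ((range n).filter fun i => M n (i + 1) = b (i + 1)).card :=
  card_filter_extendTri zero_le_one b M

/-- The generating function of the monotone triangles of order `n` with bottom row `b`. -/
noncomputable def mtSum {R : Type*} [CommRing R] (u v : R) (n : ℕ) (b : ℕ → ℤ) : R :=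
  ∑ M ∈ mtFinset n b, u ^ invMT n M * v ^ invMT' n M

theorem mtSum_zero {R : Type*} [CommRing R] (u v : R) (b : ℕ → ℤ) : mtSum u v 0 b = 1 := by
  simp [mtSum, mtFinset, invMT, invMT']

open Classical in
theorem mtSum_succ {R : Type*} [CommRing R] (u v : R) (n : ℕ) (b : ℕ → ℤ) :
    mtSum u v (n + 1) b =
      ∑ l ∈ (Fintype.piFinset fun i : Fin n => Icc (b (i + 1)) (b (i + 2))).filter fun l =>
          ∀ i, i + 1 < n → extendRow l (i + 1) < extendRow l (i + 1 + 1),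
        coincWt u v (fun i => b (i + 1)) (fun i => extendRow l (i + 1)) n *
          mtSum u v n (extendRow l) := by
  have hrow : ∀ (l : Fin n → ℤ), ∀ M ∈ mtFinset n (extendRow l), ∀ i < n,
      M n (i + 1) = extendRow l (i + 1) := fun l M hM i hi =>
    (mem_mtFinset.1 hM).2 _ (by simp; omega)
  rw [mtSum, mtFinset, Finset.sum_biUnion]
  · refine Finset.sum_congr rfl fun l _ => ?_
    rw [Finset.sum_image, mtSum, Finset.mul_sum]
    · refine Finset.sum_congr rfl fun M hM => ?_
      rw [invMT_extendTri, invMT'_extendTri, pow_add, pow_add, coincWt, Finset.prod_mul_distrib,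
        ← Finset.prod_filter, ← Finset.prod_filter, Finset.prod_const, Finset.prod_const]
      have h1 : ∀ c : ℕ → ℤ, (range n).filter (fun i => M n (i + 1) = c i) =
          (range n).filter fun i => extendRow l (i + 1) = c i := fun c =>
        Finset.filter_congr fun i hi => by rw [hrow l M hM i (by simpa using hi)]
      rw [h1 fun i => b (i + 1), h1 fun i => b (i + 1 + 1)]
      ring
    · intro M hM M' hM' h
      funext i j
      rcases eq_or_ne i (n + 1) with rfl | hi
      · rw [(mem_mtFinset.1 hM).1.2.2 _ _ (by omega), (mem_mtFinset.1 hM').1.2.2 _ _ (by omega)]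
      · simpa [extendTri, hi] using congrFun (congrFun h i) j
  · intro l _ l' _ hll'
    refine Finset.disjoint_left.2 fun M hM hM' => hll' ?_
    obtain ⟨N, hN, rfl⟩ := mem_image.1 hM
    obtain ⟨N', hN', h⟩ := mem_image.1 hM'
    funext i
    have := congrFun (congrFun h n) (i + 1)
    simp only [extendTri, show n ≠ n + 1 by omega, if_false] at this
    rw [hrow l N hN i i.2, hrow l' N' hN' i i.2, extendRow_succ, extendRow_succ] at this
    exact this.symm

theorem rowWt_eq_transfer_extendRow {R : Type*} [CommRing R] (u v : R) {n : ℕ} (b : ℕ → ℤ)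
    (l : Fin n → ℤ) :
    rowWt u v (fun j : Fin (n + 1) => b (j + 1)) l =
      (transfer u v (fun i => b (i + 1)) (fun i => extendRow l (i + 1)) n).1 +
        (transfer u v (fun i => b (i + 1)) (fun i => extendRow l (i + 1)) n).2 := by
  rw [← rowWt_eq_transfer]
  simp only [extendRow_succ]

theorem opFormula_eq_mtSum {R : Type*} [CommRing R] (u v : R) (n : ℕ) (b : ℕ → ℤ)
    (hb : ∀ i, 1 ≤ i → i < n → b i < b (i + 1)) : opFormula u v n b = mtSum u v n b := by
  induction n generalizing b with
  | zero => rw [opFormula_zero, mtSum_zero]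
  | succ n ih =>
    rw [opFormula_succ u v n b fun i h1 h2 => (hb i h1 h2).le, mtSum_succ, Finset.sum_filter]
    refine Finset.sum_congr rfl fun l hl => ?_
    rw [rowWt_eq_transfer_extendRow]
    rcases transfer_sum_of_strict u v (fun i => b (i + 1)) (fun i => extendRow l (i + 1)) n
      (fun i hi => hb (i + 1) (by omega) (by omega)) ((mem_box_iff b l).1 hl) with
      ⟨hs, ht⟩ | ⟨hs, ht⟩
    · rw [ht, if_pos hs, ih]
      intro i h1 h2
      simpa [Nat.sub_add_cancel h1] using hs (i - 1) (by omega)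
    · rw [ht, if_neg hs, zero_mul]

theorem mtSum_one_one {R : Type*} [CommRing R] (n : ℕ) (b : ℕ → ℤ) :
    mtSum (1 : R) 1 n b = (mtFinset n b).card := by
  simp [mtSum]

theorem map_opFormula_eq_card {R S : Type*} [CommRing R] [CommRing S] (φ : R →+* S) {u v : R}
    (hu : φ u = 1) (hv : φ v = 1) (n : ℕ) (b : ℕ → ℤ)
    (hb : ∀ i, 1 ≤ i → i < n → b i ≤ b (i + 1)) :
    φ (opFormula u v n b) = (mtFinset n b).card := by
  induction n generalizing b with
  | zero => rw [opFormula_zero, map_one, ← mtSum_one_one, mtSum_zero]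
  | succ n ih =>
    rw [opFormula_succ u v n b hb, ← mtSum_one_one, mtSum_succ, Finset.sum_filter, map_sum]
    refine Finset.sum_congr rfl fun l hl => ?_
    have hl := (mem_box_iff b l).1 hl
    rw [map_mul, map_rowWt, hu, hv, rowWt_eq_transfer_extendRow, mtSum_one_one, ih]
    · rcases transfer_sum_of_weak (A := S) (fun i => b (i + 1)) (fun i => extendRow l (i + 1)) n
        hl with ⟨i, hi, h1, h2⟩ | ⟨hs, ht⟩ | ⟨hs, ht⟩
      · simp [mtFinset_eq_empty (n := n) (Nat.le_add_left 1 i) (by omega) h1 h2]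
      · rw [ht, if_pos hs]
        simp [coincWt]
      · rw [ht, if_neg hs, zero_mul]
    · intro i h1 h2
      obtain ⟨i, rfl⟩ : ∃ i', i = i' + 1 := ⟨i - 1, by omega⟩
      exact (hl i (by omega)).2.trans (hl (i + 1) (by omega)).1

theorem coe_mtFinset (n : ℕ) (b : ℕ → ℤ) :
    (mtFinset n b : Set (ℕ → ℕ → ℤ)) = {M | IsMT n M ∧ ∀ j ∈ Icc 1 n, M n j = b j} := by
  ext M
  simp [mem_mtFinset]

end MonotoneTriangle

/-- The operator formula: for a strictly increasing bottom row,
`M_n(u,v,b_1,…,b_n) = Σ_M u^{inv(M)} v^{inv'(M)}` over monotone triangles `M` with bottom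
row `(b_1,…,b_n)`; for `u = v = 1` weak increase suffices and the evaluation counts the
monotone triangles. -/
theorem stmt0 (n : ℕ) (hn : 1 ≤ n) (b : ℕ → ℤ) :
    ((∀ i, 1 ≤ i → i < n → b i < b (i+1)) →
      MvPolynomial.eval (fun i => ((b i : ℤ) : S2)) (Mpoly n) =
        ∑ᶠ M ∈ {M : ℕ → ℕ → ℤ | IsMT n M ∧ ∀ j ∈ Finset.Icc 1 n, M n j = b j},
          Uv ^ invMT n M * Vv ^ invMT' n M) ∧
    ((∀ i, 1 ≤ i → i < n → b i ≤ b (i+1)) →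
      MvPolynomial.eval (fun _ : Fin 2 => (1 : ℚ))
          (MvPolynomial.eval (fun i => ((b i : ℤ) : S2)) (Mpoly n)) =
        (Set.ncard {M : ℕ → ℕ → ℤ | IsMT n M ∧ ∀ j ∈ Finset.Icc 1 n, M n j = b j} : ℚ)) := by
  rw [MonotoneTriangle.eval_Mpoly, ← MonotoneTriangle.coe_mtFinset, finsum_mem_coe_finset,
    Set.ncard_coe_finset]
  refine ⟨fun hb => MonotoneTriangle.opFormula_eq_mtSum Uv Vv n b hb, fun hb => ?_⟩
  exact MonotoneTriangle.map_opFormula_eq_card _ (by simp [Uv]) (by simp [Vv]) n b hb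
end

section
/- Let n ≥ 1 and let 0 ≤ b_1 < b_2 < … < b_n be integers. Then Σ_M u^{inv(M)} v^{inv'(M)}, the sum over all monotone triangles M of order n with bottom row (b_1,…,b_n), equals the constant term in x_1,…,x_n of the Laurent polynomial ∏_{i=1}^{n} (1+x_i)^{b_i} x_i^{−n+1} · ∏_{1≤i<j≤n} (x_i − x_j)(1 + (1−v)x_i + u(x_j + x_i x_j)), as an identity of polynomials in u and v. In the special case u = v = 1, the equality holds under the weaker assumption that 0 ≤ b_1 ≤ b_2 ≤ … ≤ b_n. -/
open scoped BigOperators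

/-- The exponent vector `(n−1, …, n−1)` (variables `x_1, …, x_n`);
taking this coefficient amounts to taking the constant term after multiplying
by `∏ x_i^{−n+1}`. -/
noncomputable def ctdeg (n : ℕ) : ℕ →₀ ℕ := ∑ i ∈ Finset.Icc 1 n, Finsupp.single i (n-1)

open Classical in
/-- The finset of strictly increasing sequences `a 0 < ⋯ < a (m-1)` (zero beyond) that interlace
with `b 0 ≤ ⋯ ≤ b m`. -/
noncomputable def interlacingRows (b : ℕ → ℤ) : ℕ → Finset (ℕ → ℤ)
  | 0 => {0}
  | m + 1 => ((interlacingRows b m ×ˢ Finset.Icc (b m) (b (m + 1))).filter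
      (fun p => m = 0 ∨ p.1 (m - 1) < p.2)).image (fun p => Function.update p.1 m p.2)

theorem mem_interlacingRows {b : ℕ → ℤ} {m : ℕ} {a : ℕ → ℤ} :
    a ∈ interlacingRows b m ↔ (∀ i < m, b i ≤ a i ∧ a i ≤ b (i + 1)) ∧
      (∀ i, i + 1 < m → a i < a (i + 1)) ∧ ∀ i, m ≤ i → a i = 0 := by
  induction m generalizing a with
  | zero =>
    simp only [interlacingRows, Finset.mem_singleton]
    exact ⟨by rintro rfl; simp, fun h => funext fun i => h.2.2 i (Nat.zero_le i)⟩
  | succ m ih =>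
    simp only [interlacingRows, Finset.mem_image, Finset.mem_filter, Finset.mem_product,
      Finset.mem_Icc, Prod.exists]
    constructor
    · rintro ⟨a', c, ⟨⟨ha', hc⟩, hlt⟩, rfl⟩
      obtain ⟨h1, h2, h3⟩ := ih.1 ha'
      refine ⟨fun i hi => ?_, fun i hi => ?_, fun i hi => ?_⟩
      · rcases Nat.lt_succ_iff_lt_or_eq.1 hi with h | rfl
        · simpa [Function.update_of_ne h.ne] using h1 i h
        · simpa using hc
      · rcases Nat.lt_succ_iff_lt_or_eq.1 hi with h | rfl
        · rw [Function.update_of_ne (by omega), Function.update_of_ne (by omega)]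
          exact h2 i h
        · rw [Function.update_of_ne (by omega), Function.update_self]
          simpa using hlt
      · rw [Function.update_of_ne (by omega)]
        exact h3 i (by omega)
    · rintro ⟨h1, h2, h3⟩
      refine ⟨Function.update a m 0, a m, ⟨⟨ih.2 ⟨fun i hi => ?_, fun i hi => ?_, fun i hi => ?_⟩,
        h1 m (by omega)⟩, ?_⟩, by simp⟩
      · rw [Function.update_of_ne (by omega)]
        exact h1 i (by omega)
      · rw [Function.update_of_ne (by omega), Function.update_of_ne (by omega)]
        exact h2 i (by omega)
      · rcases eq_or_ne i m with rfl | h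
        · simp
        · rw [Function.update_of_ne h]
          exact h3 i (by omega)
      · rcases m with _ | m
        · simp
        · right
          rw [Function.update_of_ne (by omega)]
          exact h2 m (by omega)

section RowSums

variable {S : Type*} [CommRing S]

theorem sum_interlacingRows_succ (b : ℕ → ℤ) (m : ℕ) (g : (ℕ → ℤ) → S) :
    ∑ a ∈ interlacingRows b (m + 1), g a =
      ∑ a ∈ interlacingRows b m, ∑ c ∈ Finset.Icc (b m) (b (m + 1)),
        if m = 0 ∨ a (m - 1) < c then g (Function.update a m c) else 0 := by
  classical
  rw [interlacingRows, Finset.sum_image, Finset.sum_filter, Finset.sum_product]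
  rintro ⟨a, c⟩ h ⟨a', c'⟩ h' heq
  simp only [Finset.coe_filter, Finset.mem_product, Set.mem_ofPred_eq] at h h' heq
  have h3 := (mem_interlacingRows.1 h.1.1).2.2
  have h3' := (mem_interlacingRows.1 h'.1.1).2.2
  have hc : c = c' := by simpa using congrFun heq m
  refine Prod.ext (funext fun i => ?_) hc
  rcases eq_or_ne i m with rfl | hi
  · simp [h3 i le_rfl, h3' i le_rfl]
  · simpa [Function.update_of_ne hi] using congrFun heq i

/-- The sum over interlacing rows of a product of entrywise weights. -/
noncomputable def rowSum (b : ℕ → ℤ) (t : ℕ → ℤ → S) (m : ℕ) : S :=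
  ∑ a ∈ interlacingRows b m, ∏ i ∈ Finset.range m, t i (a i)

/-- The part of `rowSum b t m` coming from rows with `a (m - 1) < c`. -/
noncomputable def rowSumNe (b : ℕ → ℤ) (t : ℕ → ℤ → S) (m : ℕ) (c : ℤ) : S :=
  ∑ a ∈ interlacingRows b m,
    if m = 0 ∨ a (m - 1) < c then ∏ i ∈ Finset.range m, t i (a i) else 0

theorem prod_update_range (t : ℕ → ℤ → S) (a : ℕ → ℤ) (m : ℕ) (c : ℤ) :
    ∏ i ∈ Finset.range (m + 1), t i (Function.update a m c i) =
      (∏ i ∈ Finset.range m, t i (a i)) * t m c := by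
  rw [Finset.prod_range_succ, Function.update_self]
  congr 1
  refine Finset.prod_congr rfl fun i hi => ?_
  rw [Function.update_of_ne (Finset.mem_range.1 hi).ne]

variable {b : ℕ → ℤ} (t : ℕ → ℤ → S)

theorem rowSum_one : rowSum b t 1 = ∑ c ∈ Finset.Icc (b 0) (b 1), t 0 c := by
  rw [rowSum, sum_interlacingRows_succ]
  simp [interlacingRows]

theorem sum_interlacingRows_of_eq {m : ℕ} (hb : b m ≤ b (m + 1)) :
    ∑ a ∈ interlacingRows b (m + 1),
      (if a m = b (m + 1) then ∏ i ∈ Finset.range (m + 1), t i (a i) else 0) =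
      rowSumNe b t m (b (m + 1)) * t m (b (m + 1)) := by
  rw [sum_interlacingRows_succ, rowSumNe, Finset.sum_mul]
  refine Finset.sum_congr rfl fun a _ => ?_
  rw [Finset.sum_eq_single (b (m + 1))]
  · rw [Function.update_self, if_pos rfl, prod_update_range, ite_mul, zero_mul]
  · intro c _ hc
    rw [Function.update_self, if_neg hc, ite_self]
  · intro h
    exact absurd (Finset.mem_Icc.2 ⟨hb, le_rfl⟩) h

theorem rowSumNe_add {m : ℕ} (hb : b m ≤ b (m + 1)) (hb' : b (m + 1) ≤ b (m + 2)) :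
    rowSumNe b t (m + 1) (b (m + 2)) +
      (if b (m + 1) = b (m + 2) then rowSumNe b t m (b (m + 1)) * t m (b (m + 1)) else 0) =
      rowSum b t (m + 1) := by
  have key : ∀ a ∈ interlacingRows b (m + 1), a m ≤ b (m + 1) := fun a ha =>
    ((mem_interlacingRows.1 ha).1 m (by omega)).2
  rw [← sum_interlacingRows_of_eq t hb, rowSumNe, rowSum]
  split_ifs with h
  · rw [← Finset.sum_add_distrib]
    refine Finset.sum_congr rfl fun a ha => ?_
    have := key a ha
    rcases this.lt_or_eq with h' | h'
    · rw [if_pos (by right; simpa [← h] using h'), if_neg h'.ne, add_zero]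
    · rw [if_neg (by simp [h', h]), if_pos h', zero_add]
  · rw [add_zero]
    refine Finset.sum_congr rfl fun a ha => ?_
    have := key a ha
    rw [if_pos (by right; simp; omega)]

theorem rowSum_add_two {m : ℕ} (hb : b m ≤ b (m + 1)) (hb' : b (m + 1) ≤ b (m + 2)) :
    rowSum b t (m + 2) + rowSumNe b t m (b (m + 1)) * t m (b (m + 1)) * t (m + 1) (b (m + 1)) =
      rowSum b t (m + 1) * ∑ c ∈ Finset.Icc (b (m + 1)) (b (m + 2)), t (m + 1) c := by
  rw [← sum_interlacingRows_of_eq t hb, rowSum, sum_interlacingRows_succ, rowSum, Finset.sum_mul,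
    Finset.sum_mul, ← Finset.sum_add_distrib]
  refine Finset.sum_congr rfl fun a ha => ?_
  have hle : a m ≤ b (m + 1) := ((mem_interlacingRows.1 ha).1 m (by omega)).2
  simp only [prod_update_range, Nat.add_sub_cancel, Nat.succ_ne_zero, false_or]
  rw [ite_mul, zero_mul, Finset.mul_sum]
  split_ifs with h
  · rw [← Finset.sum_erase_add _ _ (Finset.mem_Icc.2 ⟨le_rfl, hb'⟩),
      ← Finset.sum_erase_add (Finset.Icc (b (m + 1)) (b (m + 2))) (fun c => _ * t (m + 1) c)
        (Finset.mem_Icc.2 ⟨le_rfl, hb'⟩), if_neg (by omega), add_zero]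
    congr 1
    refine Finset.sum_congr rfl fun c hc => ?_
    rw [Finset.mem_erase, Finset.mem_Icc] at hc
    rw [if_pos (by omega)]
  · rw [add_zero]
    refine Finset.sum_congr rfl fun c hc => ?_
    rw [Finset.mem_Icc] at hc
    rw [if_pos (by omega)]

end RowSums

section AlternatingSum

variable {S : Type*} [CommRing S]

/-- The weight of the entry `c` in position `i` of a row lying above the row `b`. -/
def entryWeight (u v : S) (b : ℕ → ℤ) (i : ℕ) (c : ℤ) : S :=
  (if c = b (i + 1) then u else 1) * (if c = b i then v else 1)

/-- The weighted monomial attached to the entry `c` in position `i`. -/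
def entryTerm (u v : S) (b : ℕ → ℤ) (x : ℕ → S) (i : ℕ) (c : ℤ) : S :=
  entryWeight u v b i c * (x i * (1 + x i) ^ c.toNat)

/-- The factor attached to the `i`-th variable when the entry below it to the left is used. -/
def leftTerm (v : S) (b : ℕ → ℤ) (x : ℕ → S) (i : ℕ) : S :=
  (1 + x i) ^ (b i).toNat * (1 + (1 - v) * x i)

/-- The factor attached to the `i`-th variable when the entry below it to the right is used. -/
def rightTerm (u : S) (b : ℕ → ℤ) (x : ℕ → S) (i : ℕ) : S :=
  (1 + x i) ^ (b (i + 1)).toNat * (1 + u * x i)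

/-- The alternating sum over the entry of the bottom row that is left out. -/
def omitSum (u v : S) (b : ℕ → ℤ) (x : ℕ → S) : ℕ → S
  | 0 => 1
  | m + 1 => omitSum u v b x m * rightTerm u b x m +
      (-1) ^ (m + 1) * ∏ i ∈ Finset.range (m + 1), leftTerm v b x i

/-- The factor attached to a pair of variables, apart from their difference. -/
def pairFactor (u v y z : S) : S := 1 + (1 - v) * y + u * (z + y * z)

theorem omitSum_add_two (u v : S) (b : ℕ → ℤ) (x : ℕ → S) (m : ℕ) :
    omitSum u v b x (m + 2) =
      omitSum u v b x (m + 1) * (rightTerm u b x (m + 1) - leftTerm v b x (m + 1)) +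
      omitSum u v b x m * (rightTerm u b x m * leftTerm v b x (m + 1)) := by
  simp only [omitSum, Finset.prod_range_succ]
  ring

theorem sum_Icc_mul_one_add_pow (y : S) {β γ : ℤ} (hβ : 0 ≤ β) (hβγ : β ≤ γ) :
    ∑ c ∈ Finset.Icc β γ, y * (1 + y) ^ c.toNat =
      (1 + y) ^ γ.toNat * (1 + y) - (1 + y) ^ β.toNat := by
  induction γ, hβγ using Int.leInduction with
  | base => simp; ring
  | succ γ h ih =>
    have : Finset.Icc β (γ + 1) = insert (γ + 1) (Finset.Icc β γ) := by
      ext c; simp; omega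
    rw [this, Finset.sum_insert (by simp), ih,
      show (γ + 1).toNat = γ.toNat + 1 by omega]
    ring

theorem sum_entryTerm (u v : S) {b : ℕ → ℤ} (x : ℕ → S) {i : ℕ} (h0 : 0 ≤ b i)
    (hb : b i < b (i + 1) ∨ u = 1 ∧ v = 1 ∧ b i ≤ b (i + 1)) :
    ∑ c ∈ Finset.Icc (b i) (b (i + 1)), entryTerm u v b x i c =
      rightTerm u b x i - leftTerm v b x i := by
  have hle : b i ≤ b (i + 1) := by omega
  have key : ∀ c, entryTerm u v b x i c = x i * (1 + x i) ^ c.toNat +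
      (if c = b (i + 1) then (u - 1) * (x i * (1 + x i) ^ c.toNat) else 0) +
      (if c = b i then (v - 1) * (x i * (1 + x i) ^ c.toNat) else 0) := by
    intro c
    unfold entryTerm entryWeight
    rcases hb with hb | ⟨rfl, rfl, -⟩
    · split_ifs with h h'
      · omega
      all_goals ring
    · simp
  simp only [key, Finset.sum_add_distrib, Finset.sum_ite_eq', Finset.mem_Icc, le_refl, hle,
    and_self, if_true, sum_Icc_mul_one_add_pow (x i) h0 hle, rightTerm, leftTerm]
  ring

/-- `P` is annihilated by `φ` after multiplication with anything that is invariant under the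
first `m - 1` of the maps `s k`. -/
def IsNegligible {T : Type*} [AddCommGroup T] (φ : S →+ T) (s : ℕ → S →+* S) (m : ℕ) (P : S) :
    Prop :=
  ∀ Q, (∀ k, k + 1 < m → s k Q = Q) → φ (P * Q) = 0

namespace IsNegligible

variable {T : Type*} [AddCommGroup T] {φ : S →+ T} {s : ℕ → S →+* S} {m : ℕ} {P P' : S}

theorem zero : IsNegligible φ s m 0 := fun Q _ => by simp

theorem add (h : IsNegligible φ s m P) (h' : IsNegligible φ s m P') :
    IsNegligible φ s m (P + P') := fun Q hQ => by
  rw [add_mul, map_add, h Q hQ, h' Q hQ, add_zero]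

theorem neg (h : IsNegligible φ s m P) : IsNegligible φ s m (-P) := fun Q hQ => by
  rw [neg_mul, map_neg, h Q hQ, neg_zero]

theorem mul {m' : ℕ} (h : IsNegligible φ s m P) (hm : m ≤ m') {Y : S}
    (hY : ∀ k, k + 1 < m → s k Y = Y) : IsNegligible φ s m' (P * Y) := fun Q hQ => by
  rw [mul_assoc]
  exact h _ fun k hk => by rw [map_mul, hY k hk, hQ k (by omega)]

end IsNegligible

theorem map_entryTerm {u v : S} (b : ℕ → ℤ) {x : ℕ → S} (σ : S →+* S) (hu : σ u = u)
    (hv : σ v = v) {i : ℕ} (c : ℤ) (hx : σ (x i) = x i) :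
    σ (entryTerm u v b x i c) = entryTerm u v b x i c := by
  simp only [entryTerm, entryWeight, map_mul, map_pow, map_add, map_one, hx, apply_ite σ, hu, hv]

theorem map_leftTerm {v : S} (b : ℕ → ℤ) {x : ℕ → S} (σ : S →+* S)
    (hv : σ v = v) {i : ℕ} (hx : σ (x i) = x i) : σ (leftTerm v b x i) = leftTerm v b x i := by
  simp only [leftTerm, map_mul, map_pow, map_add, map_sub, map_one, hx, hv]

theorem map_rightTerm {u : S} (b : ℕ → ℤ) {x : ℕ → S} (σ : S →+* S)
    (hu : σ u = u) {i : ℕ} (hx : σ (x i) = x i) : σ (rightTerm u b x i) = rightTerm u b x i := by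
  simp only [rightTerm, map_mul, map_pow, map_add, map_one, hx, hu]

theorem map_rowSum (b : ℕ → ℤ) (t : ℕ → ℤ → S) (σ : S →+* S) {m : ℕ}
    (ht : ∀ i < m, ∀ c, σ (t i c) = t i c) : σ (rowSum b t m) = rowSum b t m := by
  rw [rowSum, map_sum]
  refine Finset.sum_congr rfl fun a _ => ?_
  rw [map_prod]
  exact Finset.prod_congr rfl fun i hi => ht i (Finset.mem_range.1 hi) _

theorem map_rowSumNe (b : ℕ → ℤ) (t : ℕ → ℤ → S) (σ : S →+* S) {m : ℕ} (c : ℤ)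
    (ht : ∀ i < m, ∀ c, σ (t i c) = t i c) : σ (rowSumNe b t m c) = rowSumNe b t m c := by
  rw [rowSumNe, map_sum]
  refine Finset.sum_congr rfl fun a _ => ?_
  rw [apply_ite σ, map_zero, map_prod]
  congr 1
  exact Finset.prod_congr rfl fun i hi => ht i (Finset.mem_range.1 hi) _

theorem isNegligible_rowSum_sub_omitSum {T : Type*} [AddCommGroup T] (φ : S →+ T)
    (s : ℕ → S →+* S) {N : ℕ} {u v : S} {b : ℕ → ℤ} {x : ℕ → S}
    (hb0 : ∀ i < N, 0 ≤ b i)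
    (hb : ∀ i < N, b i < b (i + 1) ∨ u = 1 ∧ v = 1 ∧ b i ≤ b (i + 1))
    (hu : ∀ k, k + 1 < N → s k u = u) (hv : ∀ k, k + 1 < N → s k v = v)
    (hx : ∀ k, k + 1 < N → ∀ i, i ≠ k → i ≠ k + 1 → s k (x i) = x i)
    (hxl : ∀ k, k + 1 < N → s k (x k) = x (k + 1))
    (hxr : ∀ k, k + 1 < N → s k (x (k + 1)) = x k)
    (hφ : ∀ k, k + 1 < N → ∀ P, s k P = P → φ (P * pairFactor u v (x (k + 1)) (x k)) = 0)
    (hφ' : u = 1 → v = 1 → ∀ k, k + 2 < N → ∀ P, s k P = P → s (k + 1) P = P → φ P = 0)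
    {m : ℕ} (hm : m ≤ N) :
    IsNegligible φ s m (rowSum b (entryTerm u v b x) m - omitSum u v b x m) := by
  have ht : ∀ m, ∀ k, k + 1 < N → m ≤ k → ∀ i < m, ∀ c,
      s k (entryTerm u v b x i c) = entryTerm u v b x i c := fun m k hk hm i hi c =>
    map_entryTerm b (s k) (hu k hk) (hv k hk) c (hx k hk i (by omega) (by omega))
  induction m using Nat.strong_induction_on with
  | _ m ih =>
  rcases m with _ | _ | m
  · simpa [rowSum, omitSum, interlacingRows] using IsNegligible.zero
  · rw [rowSum_one, sum_entryTerm u v x (hb0 0 (by omega)) (hb 0 (by omega))]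
    simpa [omitSum, sub_eq_add_neg] using IsNegligible.zero
  have hb1 := hb m (by omega)
  have hb2 := hb (m + 1) (by omega)
  have hle : b m ≤ b (m + 1) := by omega
  have hle' : b (m + 1) ≤ b (m + 2) := by
    rcases hb2 with h | h
    exacts [h.le, h.2.2]
  have hsum := sum_entryTerm u v x (hb0 (m + 1) (by omega)) hb2
  have hA := rowSum_add_two (entryTerm u v b x) hle hle'
  rw [hsum] at hA
  have h1 : entryTerm u v b x m (b (m + 1)) = u * (x m * (1 + x m) ^ (b (m + 1)).toNat) := by
    unfold entryTerm entryWeight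
    rcases hb1 with h | ⟨rfl, rfl, -⟩
    · simp [h.ne']
    · simp
  have h2 : entryTerm u v b x (m + 1) (b (m + 1)) =
      v * (x (m + 1) * (1 + x (m + 1)) ^ (b (m + 1)).toNat) := by
    unfold entryTerm entryWeight
    rcases hb2 with h | ⟨rfl, rfl, -⟩
    · simp [h.ne]
    · simp
  have hpair : IsNegligible φ s (m + 2) (rowSum b (entryTerm u v b x) m *
      ((1 + x m) ^ (b (m + 1)).toNat * (1 + x (m + 1)) ^ (b (m + 1)).toNat) *
        pairFactor u v (x (m + 1)) (x m)) := by
    intro Q hQ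
    rw [mul_right_comm]
    refine hφ m (by omega) _ ?_
    simp only [map_mul, map_pow, map_add, map_one, hxl m (by omega), hxr m (by omega),
      hQ m (by omega), map_rowSum b _ (s m) (ht m m (by omega) le_rfl)]
    ring
  have hI : ∀ k, k + 1 < m + 1 →
      s k (rightTerm u b x (m + 1) - leftTerm v b x (m + 1)) =
        rightTerm u b x (m + 1) - leftTerm v b x (m + 1) := fun k hk => by
    have := hx k (by omega) (m + 1) (by omega) (by omega)
    rw [map_sub, map_leftTerm b _ (hv k (by omega)) this, map_rightTerm b _ (hu k (by omega)) this]
  have hRL : ∀ k, k + 1 < m →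
      s k (rightTerm u b x m * leftTerm v b x (m + 1)) =
        rightTerm u b x m * leftTerm v b x (m + 1) := fun k hk => by
    rw [map_mul, map_leftTerm b _ (hv k (by omega)) (hx k (by omega) _ (by omega) (by omega)),
      map_rightTerm b _ (hu k (by omega)) (hx k (by omega) _ (by omega) (by omega))]
  have main := (((ih (m + 1) (by omega) (by omega)).mul (by omega : m + 1 ≤ m + 2) hI).add
    ((ih m (by omega) (by omega)).mul (by omega : m ≤ m + 2) hRL)).add hpair.neg
  have htriple : IsNegligible φ s (m + 2) ((rowSum b (entryTerm u v b x) m -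
      rowSumNe b (entryTerm u v b x) m (b (m + 1))) *
      (entryTerm u v b x m (b (m + 1)) * entryTerm u v b x (m + 1) (b (m + 1)))) := by
    rcases m with _ | m
    · simpa [rowSum, rowSumNe] using IsNegligible.zero
    rw [← rowSumNe_add (entryTerm u v b x) (by have := hb m (by omega); omega) hle,
      add_sub_cancel_left]
    split_ifs with h
    · obtain ⟨hu1, hv1, -⟩ := hb1.resolve_left h.not_lt
      intro Q hQ
      have ht' : ∀ i c, entryTerm u v b x i c = x i * (1 + x i) ^ c.toNat := fun i c => by
        simp [entryTerm, entryWeight, hu1, hv1]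
      refine hφ' hu1 hv1 m (by omega) _ ?_ ?_
      · simp only [map_mul, hQ m (by omega),
          map_rowSumNe b _ (s m) _ (ht m m (by omega) le_rfl)]
        simp only [ht', map_mul, map_pow, map_add, map_one, hxl m (by omega), hxr m (by omega),
          hx m (by omega) (m + 1 + 1) (by omega) (by omega), h]
        ring
      · simp only [map_mul, hQ (m + 1) (by omega),
          map_rowSumNe b _ (s (m + 1)) _ (ht m (m + 1) (by omega) (by omega))]
        simp only [ht', map_mul, map_pow, map_add, map_one, hxl (m + 1) (by omega),
          hxr (m + 1) (by omega), hx (m + 1) (by omega) m (by omega) (by omega), h]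
        ring
    · simpa using IsNegligible.zero
  convert main.add htriple using 1
  rw [omitSum_add_two, eq_sub_of_add_eq hA, h1, h2]
  unfold rightTerm leftTerm pairFactor
  ring

theorem map_rowSum_eq_map_omitSum {T : Type*} [AddCommGroup T] (φ : S →+ T)
    (s : ℕ → S →+* S) {N : ℕ} {u v : S} {b : ℕ → ℤ} {x : ℕ → S}
    (hb0 : ∀ i < N, 0 ≤ b i)
    (hb : ∀ i < N, b i < b (i + 1) ∨ u = 1 ∧ v = 1 ∧ b i ≤ b (i + 1))
    (hu : ∀ k, k + 1 < N → s k u = u) (hv : ∀ k, k + 1 < N → s k v = v)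
    (hx : ∀ k, k + 1 < N → ∀ i, i ≠ k → i ≠ k + 1 → s k (x i) = x i)
    (hxl : ∀ k, k + 1 < N → s k (x k) = x (k + 1))
    (hxr : ∀ k, k + 1 < N → s k (x (k + 1)) = x k)
    (hφ : ∀ k, k + 1 < N → ∀ P, s k P = P → φ (P * pairFactor u v (x (k + 1)) (x k)) = 0)
    (hφ' : u = 1 → v = 1 → ∀ k, k + 2 < N → ∀ P, s k P = P → s (k + 1) P = P → φ P = 0) :
    φ (rowSum b (entryTerm u v b x) N) = φ (omitSum u v b x N) := by
  have := isNegligible_rowSum_sub_omitSum φ s hb0 hb hu hv hx hxl hxr hφ hφ' le_rfl 1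
    fun k _ => map_one _
  rwa [mul_one, map_sub, sub_eq_zero] at this

end AlternatingSum

section ConstantTerm

open MvPolynomial

variable {R : Type*} [CommRing R]

/-- The exponent vector with all entries equal to `d`. -/
noncomputable def constExp (N d : ℕ) : Fin N →₀ ℕ := Finsupp.equivFunOnFinite.symm fun _ => d

@[simp]
theorem constExp_apply (N d : ℕ) (i : Fin N) : constExp N d i = d := rfl

/-- The product of the factors attached to pairs of variables. -/
noncomputable def pairProd (u v : R) (N : ℕ) : MvPolynomial (Fin N) R :=
  ∏ i, ∏ j, if i < j then (X i - X j) * pairFactor (C u) (C v) (X i) (X j) else 1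

/-- The coefficient extraction applied to polynomials in the entries above the bottom row. -/
noncomputable def pairCoeff (u v : R) (N : ℕ) : MvPolynomial (Fin N) R →+ R :=
  (lcoeff R (constExp N N)).toAddMonoidHom.comp (AddMonoidHom.mulRight (pairProd u v N))

theorem pairCoeff_apply (u v : R) (N : ℕ) (P : MvPolynomial (Fin N) R) :
    pairCoeff u v N P = coeff (constExp N N) (P * pairProd u v N) := rfl

/-- The constant term expression, with the monomial `∏ x_i ^ (1 - n)` moved into the
exponent vector. -/
noncomputable def rowConstantTerm (u v : R) (n : ℕ) (a : ℕ → ℤ) : R :=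
  coeff (constExp n (n - 1)) ((∏ i : Fin n, (1 + X i) ^ (a i).toNat) * pairProd u v n)

theorem coeff_constExp_rename {N : ℕ} (e : Equiv.Perm (Fin N)) (d : ℕ)
    (P : MvPolynomial (Fin N) R) : coeff (constExp N d) (rename e P) = coeff (constExp N d) P := by
  have : (constExp N d).mapDomain e = constExp N d := by
    ext i
    rw [Finsupp.mapDomain_equiv_apply]
    simp
  conv_lhs => rw [← this]
  exact coeff_rename_mapDomain _ e.injective _ _

theorem rename_prod_pairs {N : ℕ} (e : Equiv.Perm (Fin N)) (p : Fin N → Fin N → Prop)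
    [∀ i j, Decidable (p i j)] (hp : ∀ i j, p (e i) (e j) ↔ p i j)
    (f : Fin N → Fin N → MvPolynomial (Fin N) R)
    (hf : ∀ i j, rename e (f i j) = f (e i) (e j)) :
    rename e (∏ i, ∏ j, if p i j then f i j else 1) = ∏ i, ∏ j, if p i j then f i j else 1 := by
  rw [map_prod]
  refine Eq.trans (Finset.prod_congr rfl fun i _ => ?_) (Equiv.prod_comp e _)
  rw [map_prod]
  refine Eq.trans ?_ (Equiv.prod_comp e _)
  refine Finset.prod_congr rfl fun j _ => ?_
  simp only [apply_ite (rename e), hf, map_one, hp]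

theorem rename_pairFactor {N : ℕ} (e : Fin N → Fin N) (u v : R) (i j : Fin N) :
    rename e (pairFactor (C u) (C v) (X i) (X j)) =
      pairFactor (C u) (C v) (X (e i)) (X (e j) : MvPolynomial (Fin N) R) := by
  simp [pairFactor]

theorem eq_zero_of_rename_swap_eq_neg [IsDomain R] [CharZero R] {N : ℕ}
    (e : Equiv.Perm (Fin N)) (d : ℕ) {P : MvPolynomial (Fin N) R} (h : rename e P = -P) :
    coeff (constExp N d) P = 0 := by
  have := coeff_constExp_rename e d P
  rw [h, coeff_neg] at this
  exact self_eq_neg.1 this.symm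

theorem prod_pairs_eq_mul {S : Type*} [CommRing S] {N : ℕ} (f : Fin N → Fin N → S)
    {k l : Fin N} (p : Fin N → Fin N → Prop) [∀ i j, Decidable (p i j)] (hkl : p k l) :
    (∏ i, ∏ j, if p i j then f i j else 1) =
      f k l * ∏ i, ∏ j, if p i j ∧ ¬(i = k ∧ j = l) then f i j else 1 := by
  have : f k l = ∏ i, ∏ j, if i = k ∧ j = l then f i j else 1 := by
    simp [ite_and]
  rw [this]
  simp only [← Finset.prod_mul_distrib]
  refine Finset.prod_congr rfl fun i _ => Finset.prod_congr rfl fun j _ => ?_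
  by_cases h : i = k ∧ j = l
  · obtain ⟨rfl, rfl⟩ := h
    simp [hkl]
  · simp [h]

theorem prod_pairs_eq_mul_triple {S : Type*} [CommRing S] {N : ℕ} (f : Fin N → Fin N → S)
    {k l m : Fin N} (hkl : k < l) (hlm : l < m) :
    (∏ i, ∏ j, if i < j then f i j else 1) = f k l * (f k m * (f l m * ∏ i, ∏ j,
      if ((i < j ∧ ¬(i = k ∧ j = l)) ∧ ¬(i = k ∧ j = m)) ∧ ¬(i = l ∧ j = m) then f i j else 1)) := by
  rw [prod_pairs_eq_mul f (fun i j => i < j) hkl,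
    prod_pairs_eq_mul f (fun i j => i < j ∧ ¬(i = k ∧ j = l)) (k := k) (l := m)
      ⟨hkl.trans hlm, by simp [hlm.ne']⟩,
    prod_pairs_eq_mul f (fun i j => (i < j ∧ ¬(i = k ∧ j = l)) ∧ ¬(i = k ∧ j = m))
      (k := l) (l := m) ⟨⟨hlm, by simp [hkl.ne']⟩, by simp [hkl.ne']⟩]

theorem pairCoeff_mul_pairFactor [IsDomain R] [CharZero R] (u v : R) {N : ℕ} {k l : Fin N}
    (hkl : (l : ℕ) = k + 1) {P : MvPolynomial (Fin N) R}
    (hP : rename (Equiv.swap k l) P = P) :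
    pairCoeff u v N (P * pairFactor (C u) (C v) (X l) (X k)) = 0 := by
  rw [pairCoeff_apply]
  apply eq_zero_of_rename_swap_eq_neg (Equiv.swap k l)
  rw [pairProd, prod_pairs_eq_mul _ (k := k) (l := l) (fun i j => i < j) (by simp [Fin.lt_def, hkl])]
  rw [map_mul, map_mul, map_mul, rename_prod_pairs, map_mul, map_sub, rename_pairFactor,
    rename_pairFactor, hP]
  · simp only [rename_X, Equiv.swap_apply_left, Equiv.swap_apply_right]
    ring
  · intro i j
    simp only [Equiv.swap_apply_def]
    grind
  · intro i j
    simp [rename_pairFactor]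

theorem coeff_mul_pairFactor_triple [IsDomain R] [CharZero R] {N : ℕ} (d : ℕ) {k l m : Fin N}
    (hkl : k ≠ l) (hkm : k ≠ m) (hlm : l ≠ m) {Y : MvPolynomial (Fin N) R}
    (hY : rename (Equiv.swap k l) Y = -Y) (hY' : rename (Equiv.swap l m) Y = -Y) :
    coeff (constExp N d) (Y * (pairFactor (C 1) (C 1) (X k) (X l) *
      pairFactor (C 1) (C 1) (X k) (X m) * pairFactor (C 1) (C 1) (X l) (X m))) = 0 := by
  set g : Fin N → Fin N → Fin N → R := fun a b c => coeff (constExp N d)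
    (Y * (pairFactor (C 1) (C 1) (X a) (X b) * pairFactor (C 1) (C 1) (X a) (X c) *
      pairFactor (C 1) (C 1) (X b) (X c))) with hg
  have hs : ∀ e : Equiv.Perm (Fin N), rename e Y = -Y → ∀ a b c,
      g (e a) (e b) (e c) = -g a b c := by
    intro e he a b c
    simp only [hg]
    rw [← coeff_constExp_rename e _ (Y * (pairFactor (C 1) (C 1) (X a) (X b) * _ * _))]
    simp only [map_mul, he, rename_pairFactor, neg_mul, coeff_neg, neg_neg]
  have e1 := hs _ hY k l m
  have e2 := hs _ hY' k l m
  have e3 := hs _ hY k m l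
  have e4 := hs _ hY' l k m
  have e5 := hs _ hY m k l
  simp only [Equiv.swap_apply_left, Equiv.swap_apply_right,
    Equiv.swap_apply_of_ne_of_ne hkm.symm hlm.symm,
    Equiv.swap_apply_of_ne_of_ne hkl hkm] at e1 e2 e3 e4 e5
  have hsum : g k l m - g l k m - g k m l + g l m k + g m k l - g m l k = 0 := by
    simp only [hg, ← coeff_add, ← coeff_sub, ← mul_add, ← mul_sub]
    convert coeff_zero (constExp N d)
    unfold pairFactor
    simp only [map_one]
    ring
  rw [e5, e3, e4, e1, e2] at hsum
  have h6 : (6 : R) * g k l m = 0 := by linear_combination hsum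
  exact (mul_eq_zero.1 h6).resolve_left (by norm_num)

theorem pairCoeff_eq_zero [IsDomain R] [CharZero R] {N : ℕ} {k l m : Fin N}
    (hkl : (l : ℕ) = k + 1) (hlm : (m : ℕ) = l + 1) {P : MvPolynomial (Fin N) R}
    (hP : rename (Equiv.swap k l) P = P) (hP' : rename (Equiv.swap l m) P = P) :
    pairCoeff 1 1 N P = 0 := by
  have hkl' : k < l := by rw [Fin.lt_def]; omega
  have hlm' : l < m := by rw [Fin.lt_def]; omega
  have hkm : k ≠ m := (hkl'.trans hlm').ne
  rw [pairCoeff_apply, pairProd, prod_pairs_eq_mul_triple _ hkl' hlm']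
  have hf : ∀ (e : Equiv.Perm (Fin N)) (i j : Fin N),
      rename e ((X i - X j) * pairFactor (C 1) (C 1) (X i) (X j) : MvPolynomial (Fin N) R) =
        (X (e i) - X (e j)) * pairFactor (C 1) (C 1) (X (e i)) (X (e j)) := fun e i j => by
    rw [map_mul, map_sub, rename_pairFactor, rename_X, rename_X]
  have hG1 := rename_prod_pairs (Equiv.swap k l)
    (fun i j => ((i < j ∧ ¬(i = k ∧ j = l)) ∧ ¬(i = k ∧ j = m)) ∧ ¬(i = l ∧ j = m))
    (fun i j => by
      simp only [Equiv.swap_apply_def, Fin.lt_def, Fin.ext_iff]; split_ifs <;> omega) _ (hf _)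
  have hG2 := rename_prod_pairs (Equiv.swap l m)
    (fun i j => ((i < j ∧ ¬(i = k ∧ j = l)) ∧ ¬(i = k ∧ j = m)) ∧ ¬(i = l ∧ j = m))
    (fun i j => by
      simp only [Equiv.swap_apply_def, Fin.lt_def, Fin.ext_iff]; split_ifs <;> omega) _ (hf _)
  generalize (∏ i, ∏ j,
    if ((i < j ∧ ¬(i = k ∧ j = l)) ∧ ¬(i = k ∧ j = m)) ∧ ¬(i = l ∧ j = m) then
      (X i - X j) * pairFactor (C 1) (C 1) (X i) (X j) else 1 :
      MvPolynomial (Fin N) R) = G at hG1 hG2 ⊢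
  have hY : rename (Equiv.swap k l) (P * ((X k - X l) * (X k - X m) * (X l - X m)) * G) =
      -(P * ((X k - X l) * (X k - X m) * (X l - X m)) * G) := by
    simp only [map_mul, map_sub, hP, hG1, rename_X, Equiv.swap_apply_left,
      Equiv.swap_apply_right, Equiv.swap_apply_of_ne_of_ne hkm.symm hlm'.ne']
    ring
  have hY' : rename (Equiv.swap l m) (P * ((X k - X l) * (X k - X m) * (X l - X m)) * G) =
      -(P * ((X k - X l) * (X k - X m) * (X l - X m)) * G) := by
    simp only [map_mul, map_sub, hP', hG2, rename_X, Equiv.swap_apply_left,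
      Equiv.swap_apply_right, Equiv.swap_apply_of_ne_of_ne hkl'.ne hkm]
    ring
  refine (congrArg (coeff _) ?_).trans
    (coeff_mul_pairFactor_triple N hkl'.ne hkm hlm'.ne hY hY')
  ring

end ConstantTerm

section Laplace

open MvPolynomial

variable {R : Type*} [CommRing R]

theorem prod_pairs_sub_eq_sum {S : Type*} [CommRing S] {n : ℕ} (y : Fin (n + 1) → S) :
    (∏ i, ∏ j, if i < j then y i - y j else 1) =
      ∑ k : Fin (n + 1), (-1) ^ (k : ℕ) * y k ^ n *
        ∏ i, ∏ j, if i < j then y (k.succAbove i) - y (k.succAbove j) else 1 := by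
  have key : ∀ {m : ℕ} (z : Fin m → S), (∏ i, ∏ j, if i < j then z i - z j else 1) =
      (Matrix.vandermonde fun i => -z i).det := by
    intro m z
    rw [Matrix.det_vandermonde]
    refine Finset.prod_congr rfl fun i _ => ?_
    rw [← Finset.prod_filter]
    refine Finset.prod_congr (by ext; simp) fun j _ => by ring
  rw [key, Matrix.det_succ_column _ (Fin.last n)]
  refine Finset.sum_congr rfl fun k _ => ?_
  rw [key]
  congr 1
  · rw [Matrix.vandermonde_apply, Fin.val_last, neg_pow, pow_add]
    have : (-1 : S) ^ n * (-1) ^ n = 1 := by rw [← mul_pow]; simp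
    linear_combination ((-1) ^ (k : ℕ) * y k ^ n) * this
  · congr 1
    ext i j
    simp [Matrix.vandermonde_apply]

theorem prod_pairs_succAbove {S : Type*} [CommRing S] {n : ℕ} (k : Fin (n + 1))
    (f : Fin (n + 1) → Fin (n + 1) → S) :
    (∏ i, ∏ j, if i < j then f i j else 1) =
      (∏ i : Fin n, if i.castSucc < k then f (k.succAbove i) k else f k (k.succAbove i)) *
        ∏ i : Fin n, ∏ j : Fin n, if i < j then f (k.succAbove i) (k.succAbove j) else 1 := by
  simp only [Fin.prod_univ_succAbove _ k, lt_irrefl, if_false, one_mul,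
    Finset.prod_mul_distrib, k.succAbove_lt_succAbove_iff]
  rw [← mul_assoc, ← Finset.prod_mul_distrib]
  congr 1
  refine Finset.prod_congr rfl fun i _ => ?_
  simp only [Fin.succAbove_lt_iff_castSucc_lt, Fin.lt_succAbove_iff_le_castSucc]
  by_cases h : i.castSucc < k
  · simp [h, h.not_ge]
  · simp [h, not_lt.1 h]

theorem coeff_X_pow_mul_eq_coeff_aeval_insertNth {n : ℕ} (k : Fin (n + 1)) (d : ℕ)
    (P : MvPolynomial (Fin (n + 1)) R) :
    coeff (constExp (n + 1) d) (X k ^ d * P) =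
      coeff (constExp n d) (aeval (k.insertNth 0 X : Fin (n + 1) → MvPolynomial (Fin n) R) P) := by
  induction P using MvPolynomial.induction_on' with
  | add p q hp hq => rw [mul_add, coeff_add, hp, hq, map_add, coeff_add]
  | monomial e c =>
    rw [X_pow_eq_monomial, monomial_mul, one_mul, coeff_monomial, aeval_monomial,
      Finsupp.prod_fintype _ _ (by simp), Fin.prod_univ_succAbove _ k]
    simp only [Fin.insertNth_apply_same, Fin.insertNth_apply_succAbove, algebraMap_eq, coeff_C_mul]
    have hprod : (∏ i : Fin n, (X i : MvPolynomial (Fin n) R) ^ e (k.succAbove i)) =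
        monomial (Finsupp.equivFunOnFinite.symm fun i => e (k.succAbove i)) 1 := by
      rw [monomial_eq, C_1, one_mul, Finsupp.prod_fintype _ _ (by simp)]
      rfl
    rw [hprod]
    by_cases hk : e k = 0
    · rw [hk, pow_zero, one_mul, coeff_monomial]
      have : Finsupp.single k d + e = constExp (n + 1) d ↔
          (Finsupp.equivFunOnFinite.symm fun i => e (k.succAbove i)) = constExp n d := by
        simp only [Finsupp.ext_iff, Fin.forall_iff_succAbove k]
        simp [hk]
      simp [this]
    · rw [zero_pow hk, zero_mul, coeff_zero, mul_zero, if_neg]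
      intro h
      have := DFunLike.congr_fun h k
      simp at this
      omega

/-- The variables of `MvPolynomial (Fin N) R` extended by zero to a sequence. -/
noncomputable def varSeq (R : Type*) [CommRing R] (N i : ℕ) : MvPolynomial (Fin N) R :=
  if h : i < N then X ⟨i, h⟩ else 0

@[simp]
theorem varSeq_val {N : ℕ} (i : Fin N) : varSeq R N i = X i := by simp [varSeq]

theorem omitSum_eq_sum {S : Type*} [CommRing S] (u v : S) (b : ℕ → ℤ) (x : ℕ → S) (m : ℕ) :
    omitSum u v b x m = ∑ k ∈ Finset.range (m + 1), (-1) ^ k *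
      ∏ i ∈ Finset.range m, if i < k then leftTerm v b x i else rightTerm u b x i := by
  induction m with
  | zero => simp [omitSum]
  | succ m ih =>
    rw [omitSum, ih, Finset.sum_range_succ _ (m + 1), Finset.sum_mul]
    congr 1
    · refine Finset.sum_congr rfl fun k hk => ?_
      rw [Finset.prod_range_succ, if_neg (by simpa using Finset.mem_range_succ_iff.1 hk), mul_assoc]
    · congr 1
      exact Finset.prod_congr rfl fun i hi => (if_pos (Finset.mem_range.1 hi)).symm

theorem rowConstantTerm_succ (u v : R) (n : ℕ) (b : ℕ → ℤ) :
    rowConstantTerm u v (n + 1) b =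
      pairCoeff u v n (omitSum (C u) (C v) b (varSeq R n) n) := by
  rw [omitSum_eq_sum, Finset.sum_range, map_sum, rowConstantTerm, pairProd]
  have hsplit : ∀ {m : ℕ}, (∏ i : Fin m, ∏ j : Fin m,
      if i < j then (X i - X j) * pairFactor (C u) (C v) (X i) (X j) else 1 :
        MvPolynomial (Fin m) R) =
      (∏ i, ∏ j, if i < j then X i - X j else 1) *
        ∏ i, ∏ j, if i < j then pairFactor (C u) (C v) (X i) (X j) else 1 := by
    intro m
    simp only [← Finset.prod_mul_distrib]
    refine Finset.prod_congr rfl fun i _ => Finset.prod_congr rfl fun j _ => ?_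
    split_ifs <;> simp
  rw [hsplit, prod_pairs_sub_eq_sum, Finset.sum_mul, Finset.mul_sum, coeff_sum]
  refine Finset.sum_congr rfl fun k _ => ?_
  rw [Nat.add_sub_cancel, pairCoeff_apply, Finset.prod_range]
  have hC : ((-1) ^ (k : ℕ) : MvPolynomial (Fin n) R) = C ((-1) ^ (k : ℕ)) := by simp
  have hC' : ((-1) ^ (k : ℕ) : MvPolynomial (Fin (n + 1)) R) = C ((-1) ^ (k : ℕ)) := by simp
  rw [hC, hC', mul_assoc (C _) (∏ i : Fin n, _), coeff_C_mul]
  have hre : ∀ p q r s t : MvPolynomial (Fin (n + 1)) R, p * (q * r * s * t) =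
    q * (r * (p * s * t)) := fun p q r s t => by ring
  rw [hre, coeff_C_mul, coeff_X_pow_mul_eq_coeff_aeval_insertNth]
  congr 2
  have hσ : ∀ i : Fin n, aeval (R := R) (k.insertNth 0 X : Fin (n + 1) → MvPolynomial (Fin n) R)
      (X (k.succAbove i) : MvPolynomial (Fin (n + 1)) R) = (X i : MvPolynomial (Fin n) R) := fun i => by simp
  have hσ' : aeval (R := R) (k.insertNth 0 X : Fin (n + 1) → MvPolynomial (Fin n) R)
      (X k : MvPolynomial (Fin (n + 1)) R) = (0 : MvPolynomial (Fin n) R) := by simp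
  rw [prod_pairs_succAbove k (fun i j => pairFactor (C u) (C v) (X i) (X j)),
    Fin.prod_univ_succAbove _ k, pairProd, hsplit]
  generalize aeval (R := R) (k.insertNth 0 X : Fin (n + 1) → MvPolynomial (Fin n) R) = σ at hσ hσ'
  have hσC : ∀ c, σ (C c) = C c := σ.commutes
  simp only [pairFactor, map_mul, map_prod, apply_ite σ, map_sub, map_add, map_one, map_pow, hσ,
    hσ', hσC, varSeq_val, leftTerm, rightTerm]
  simp only [add_zero, one_pow, one_mul, zero_mul, mul_zero]
  rw [mul_mul_mul_comm, ← Finset.prod_mul_distrib]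
  congr 1
  refine Finset.prod_congr rfl fun i _ => ?_
  by_cases h : i.castSucc < k
  · rw [if_pos h, if_pos (by simpa [Fin.lt_def] using h), Fin.succAbove_of_castSucc_lt _ _ h,
      Fin.val_castSucc]
  · rw [if_neg h, if_neg (by simpa [Fin.lt_def] using h),
      Fin.succAbove_of_le_castSucc _ _ (not_lt.1 h), Fin.val_succ]

end Laplace

section Recurrence

open MvPolynomial

variable {R : Type*} [CommRing R]

theorem pairCoeff_prod_mul_pow (u v : R) (N : ℕ) (a : ℕ → ℤ) :
    pairCoeff u v N (∏ i ∈ Finset.range N, varSeq R N i * (1 + varSeq R N i) ^ (a i).toNat) =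
      rowConstantTerm u v N a := by
  rw [pairCoeff_apply, rowConstantTerm, Finset.prod_range]
  simp only [varSeq_val, Finset.prod_mul_distrib]
  have hX : (∏ i : Fin N, (X i : MvPolynomial (Fin N) R)) = monomial (constExp N 1) 1 := by
    rw [monomial_eq, C_1, one_mul, Finsupp.prod_fintype _ _ (by simp)]
    simp
  have hexp : constExp N N = constExp N (N - 1) + constExp N 1 := by
    ext i
    have := i.2
    simp
    omega
  rw [hX, mul_assoc, mul_comm, hexp, coeff_mul_monomial, mul_one]

theorem rowConstantTerm_succ_eq_sum [IsDomain R] [CharZero R] {u v : R} {n : ℕ} {b : ℕ → ℤ}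
    (hb0 : ∀ i < n, 0 ≤ b i)
    (hb : ∀ i < n, b i < b (i + 1) ∨ u = 1 ∧ v = 1 ∧ b i ≤ b (i + 1)) :
    rowConstantTerm u v (n + 1) b = ∑ a ∈ interlacingRows b n,
      (∏ i ∈ Finset.range n, entryWeight u v b i (a i)) * rowConstantTerm u v n a := by
  have hx : ∀ {i} (h : i < n), varSeq R n i = X ⟨i, h⟩ := fun h => by simp [varSeq, h]
  have key := map_rowSum_eq_map_omitSum (pairCoeff u v n)
    (fun k => if h : k + 1 < n then
      (rename (Equiv.swap (⟨k, by omega⟩ : Fin n) ⟨k + 1, h⟩) :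
        MvPolynomial (Fin n) R →ₐ[R] MvPolynomial (Fin n) R).toRingHom else RingHom.id _)
    (N := n) (u := C u) (v := C v) (b := b) (x := varSeq R n) hb0
    (fun i hi => (hb i hi).imp_right fun h =>
      ⟨by rw [h.1, C_1], by rw [h.2.1, C_1], h.2.2⟩)
    (fun k hk => by simp [hk]) (fun k hk => by simp [hk])
    (fun k hk i h1 h2 => by
      by_cases hi : i < n
      · simp [hk, hx hi, Equiv.swap_apply_def, h1, h2]
      · simp [hk, varSeq, hi])
    (fun k hk => by simp [hk, hx hk, hx (show k < n by omega)])
    (fun k hk => by simp [hk, hx hk, hx (show k < n by omega)])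
    (fun k hk P hP => by
      rw [hx hk, hx (show k < n by omega)]
      exact pairCoeff_mul_pairFactor u v rfl (by simpa [hk] using hP))
    (fun hu hv k hk P hP hP' => by
      obtain rfl : u = 1 := C_injective _ _ (hu.trans C_1.symm)
      obtain rfl : v = 1 := C_injective _ _ (hv.trans C_1.symm)
      have hk' : k + 1 < n := by omega
      have hk'' : k + 1 + 1 < n := by omega
      exact pairCoeff_eq_zero (k := ⟨k, by omega⟩) (l := ⟨k + 1, hk'⟩) (m := ⟨k + 1 + 1, hk''⟩)
        rfl rfl (by simpa [hk'] using hP) (by simpa [hk''] using hP'))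
  rw [rowConstantTerm_succ, ← key, rowSum, map_sum]
  refine Finset.sum_congr rfl fun a _ => ?_
  have hC : (∏ i ∈ Finset.range n, entryWeight (C u) (C v) b i (a i) :
      MvPolynomial (Fin n) R) = C (∏ i ∈ Finset.range n, entryWeight u v b i (a i)) := by
    simp only [map_prod, entryWeight, map_mul, apply_ite C, map_one]
  simp only [entryTerm]
  rw [Finset.prod_mul_distrib, hC, ← pairCoeff_prod_mul_pow, pairCoeff_apply, mul_assoc,
    coeff_C_mul, pairCoeff_apply]

end Recurrence

section Triangles

/-- The array obtained from `M` by putting `b 0, …, b n` into row `n + 1`. -/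
def addRow (n : ℕ) (b : ℕ → ℤ) (M : ℕ → ℕ → ℤ) (i j : ℕ) : ℤ :=
  if i = n + 1 then if 1 ≤ j ∧ j ≤ n + 1 then b (j - 1) else 0 else M i j

theorem addRow_of_ne {n : ℕ} (b : ℕ → ℤ) (M : ℕ → ℕ → ℤ) {i : ℕ} (hi : i ≠ n + 1) (j : ℕ) :
    addRow n b M i j = M i j := if_neg hi

theorem addRow_succ {n : ℕ} (b : ℕ → ℤ) (M : ℕ → ℕ → ℤ) {j : ℕ} (hj : j ≤ n) :
    addRow n b M (n + 1) (j + 1) = b j := by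
  simp [addRow, hj]

open Classical in
/-- The finset of monotone triangles of order `n` with bottom row `b 0, …, b (n - 1)`. -/
noncomputable def triangles : ℕ → (ℕ → ℤ) → Finset (ℕ → ℕ → ℤ)
  | 0, _ => {0}
  | n + 1, b => (interlacingRows b n).biUnion fun a => (triangles n a).image (addRow n b)

theorem IsMT.addRow {n : ℕ} {M : ℕ → ℕ → ℤ} {a b : ℕ → ℤ} (hM : IsMT n M)
    (hMa : ∀ j < n, M n (j + 1) = a j) (ha : a ∈ interlacingRows b n) :
    IsMT (n + 1) (addRow n b M) := by
  obtain ⟨h1, h2, h3⟩ := hM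
  obtain ⟨a1, a2, -⟩ := mem_interlacingRows.1 ha
  refine ⟨fun i j hj hji hi => ?_, fun i j hj hji hi => ?_, fun i j h => ?_⟩
  · obtain ⟨j, rfl⟩ := Nat.exists_eq_add_of_le' hj
    rw [addRow_of_ne b M hi.ne]
    rcases Nat.lt_succ_iff_lt_or_eq.1 hi with h | rfl
    · rw [addRow_of_ne b M (by omega), addRow_of_ne b M (by omega)]
      exact h1 i _ hj hji h
    · rw [addRow_succ b M (by omega), addRow_succ b M (by omega), hMa j (by omega)]
      exact a1 j (by omega)
  · obtain ⟨j, rfl⟩ := Nat.exists_eq_add_of_le' hj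
    rw [addRow_of_ne b M hi.ne, addRow_of_ne b M hi.ne]
    rcases Nat.lt_succ_iff_lt_or_eq.1 hi with h | rfl
    · exact h2 i _ hj hji h
    · rw [hMa j (by omega), hMa (j + 1) (by omega)]
      exact a2 j (by omega)
  · by_cases hi : i = n + 1
    · rw [_root_.addRow, if_pos hi, if_neg (by omega)]
    · rw [addRow_of_ne b M hi]
      exact h3 i j (by omega)

theorem mem_triangles {n : ℕ} {b : ℕ → ℤ} {M : ℕ → ℕ → ℤ} :
    M ∈ triangles n b ↔ IsMT n M ∧ ∀ j < n, M n (j + 1) = b j := by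
  induction n generalizing b M with
  | zero =>
    simp only [triangles, Finset.mem_singleton]
    constructor
    · rintro rfl
      exact ⟨⟨by simp, by simp, by simp⟩, by simp⟩
    · rintro ⟨⟨-, -, h⟩, -⟩
      funext i j
      exact h i j (by omega)
  | succ n ih =>
    simp only [triangles, Finset.mem_biUnion, Finset.mem_image, ih]
    constructor
    · rintro ⟨a, ha, M, ⟨hM, hMa⟩, rfl⟩
      exact ⟨hM.addRow hMa ha, fun j hj => addRow_succ b M (by omega)⟩
    · rintro ⟨⟨h1, h2, h3⟩, hb⟩
      refine ⟨fun j => if j < n then M n (j + 1) else 0, mem_interlacingRows.2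
        ⟨fun j hj => ?_, fun j hj => ?_, fun j hj => if_neg (by omega)⟩,
        fun i j => if i ≤ n then M i j else 0,
        ⟨⟨fun i j hj hji hi => ?_, fun i j hj hji hi => ?_, fun i j h => ?_⟩, fun j hj => ?_⟩, ?_⟩
      · rw [if_pos hj, ← hb j (by omega), ← hb (j + 1) (by omega)]
        exact h1 n (j + 1) (by omega) (by omega) (by omega)
      · simp only [if_pos hj, if_pos (show j < n by omega)]
        exact h2 n (j + 1) (by omega) (by omega) (by omega)
      · simp only [if_pos hi.le, if_pos (show i + 1 ≤ n by omega)]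
        exact h1 i j hj hji (by omega)
      · simp only [if_pos hi.le]
        exact h2 i j hj hji (by omega)
      · simp only
        split_ifs
        · exact h3 i j (by omega)
        · rfl
      · simp [hj]
      · funext i j
        simp only [addRow]
        split_ifs with hi hj hi'
        · obtain ⟨j, rfl⟩ := Nat.exists_eq_add_of_le' hj.1
          rw [hi, hb j (by omega), Nat.add_sub_cancel]
        · exact (h3 i j (by omega)).symm
        · rfl
        · exact (h3 i j (by omega)).symm

variable {R : Type*} [CommRing R]

theorem sum_triangles_succ (n : ℕ) (b : ℕ → ℤ) (f : (ℕ → ℕ → ℤ) → R) :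
    ∑ M ∈ triangles (n + 1) b, f M =
      ∑ a ∈ interlacingRows b n, ∑ M ∈ triangles n a, f (addRow n b M) := by
  classical
  rw [triangles, Finset.sum_biUnion]
  · refine Finset.sum_congr rfl fun a _ => Finset.sum_image fun M hM M' hM' h => ?_
    funext i j
    by_cases hi : i = n + 1
    · rw [(mem_triangles.1 hM).1.2.2 i j (by omega), (mem_triangles.1 hM').1.2.2 i j (by omega)]
    · rw [← addRow_of_ne b M hi, h, addRow_of_ne b M' hi]
  · intro a ha a' ha' hne
    refine Finset.disjoint_left.2 fun N hN hN' => hne ?_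
    obtain ⟨M, hM, rfl⟩ := Finset.mem_image.1 hN
    obtain ⟨M', hM', h⟩ := Finset.mem_image.1 hN'
    funext j
    by_cases hj : j < n
    · rw [← (mem_triangles.1 hM).2 j hj, ← (mem_triangles.1 hM').2 j hj,
        ← addRow_of_ne b M n.lt_succ_self.ne, ← h,
        addRow_of_ne b M' n.lt_succ_self.ne]
    · rw [(mem_interlacingRows.1 ha).2.2 j (by omega), (mem_interlacingRows.1 ha').2.2 j (by omega)]

theorem pow_card_filter_lt (u : R) (n : ℕ) (p : ℕ → ℕ → Prop) [∀ i j, Decidable (p i j)] :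
    u ^ ((Finset.Icc 1 n ×ˢ Finset.Icc 1 n).filter
        (fun q => q.2 ≤ q.1 ∧ q.1 < n ∧ p q.1 q.2)).card =
      ∏ i ∈ Finset.range n, ∏ j ∈ Finset.range i, if p i (j + 1) then u else 1 := by
  rw [Finset.prod_sigma', ← Finset.prod_filter, Finset.prod_const]
  congr 1
  refine Finset.card_bij' (fun q _ => ⟨q.1, q.2 - 1⟩) (fun q _ => (q.1, q.2 + 1)) ?_ ?_ ?_ ?_
  · rintro ⟨i, j⟩ h
    simp only [Finset.mem_filter, Finset.mem_product, Finset.mem_Icc, Finset.mem_sigma,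
      Finset.mem_range] at h ⊢
    exact ⟨by omega, by rw [Nat.sub_add_cancel h.1.2.1]; exact h.2.2.2⟩
  · rintro ⟨i, j⟩ h
    simp only [Finset.mem_filter, Finset.mem_product, Finset.mem_Icc, Finset.mem_sigma,
      Finset.mem_range] at h ⊢
    exact ⟨by omega, by omega, by omega, h.2⟩
  · rintro ⟨i, j⟩ h
    simp only [Finset.mem_filter, Finset.mem_product, Finset.mem_Icc] at h
    simp [Nat.sub_add_cancel h.1.2.1]
  · rintro ⟨i, j⟩ h
    simp

theorem pow_invMT_addRow (u : R) {n : ℕ} {M : ℕ → ℕ → ℤ} {a b : ℕ → ℤ}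
    (hMa : ∀ j < n, M n (j + 1) = a j) :
    u ^ invMT (n + 1) (addRow n b M) =
      (∏ j ∈ Finset.range n, if a j = b (j + 1) then u else 1) * u ^ invMT n M := by
  rw [invMT, invMT, pow_card_filter_lt u (n + 1) fun i j =>
      addRow n b M i j = addRow n b M (i + 1) (j + 1),
    pow_card_filter_lt u n fun i j => M i j = M (i + 1) (j + 1), Finset.prod_range_succ, mul_comm]
  congr 1
  · refine Finset.prod_congr rfl fun j hj => ?_
    have hj := Finset.mem_range.1 hj
    rw [addRow_of_ne b M (by omega), addRow_succ b M (by omega), hMa j hj]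
  · refine Finset.prod_congr rfl fun i hi => Finset.prod_congr rfl fun j _ => ?_
    have hi := Finset.mem_range.1 hi
    rw [addRow_of_ne b M (by omega), addRow_of_ne b M (by omega)]

theorem pow_invMT'_addRow (v : R) {n : ℕ} {M : ℕ → ℕ → ℤ} {a b : ℕ → ℤ}
    (hMa : ∀ j < n, M n (j + 1) = a j) :
    v ^ invMT' (n + 1) (addRow n b M) =
      (∏ j ∈ Finset.range n, if a j = b j then v else 1) * v ^ invMT' n M := by
  rw [invMT', invMT', pow_card_filter_lt v (n + 1) fun i j =>
      addRow n b M i j = addRow n b M (i + 1) j,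
    pow_card_filter_lt v n fun i j => M i j = M (i + 1) j, Finset.prod_range_succ, mul_comm]
  congr 1
  · refine Finset.prod_congr rfl fun j hj => ?_
    have hj := Finset.mem_range.1 hj
    rw [addRow_of_ne b M (by omega), addRow_succ b M (by omega), hMa j hj]
  · refine Finset.prod_congr rfl fun i hi => Finset.prod_congr rfl fun j _ => ?_
    have hi := Finset.mem_range.1 hi
    rw [addRow_of_ne b M (by omega), addRow_of_ne b M (by omega)]

theorem sum_triangles_eq_rowConstantTerm [IsDomain R] [CharZero R] {u v : R} {n : ℕ} {b : ℕ → ℤ}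
    (hb0 : ∀ i < n, 0 ≤ b i)
    (hb : ∀ i, i + 1 < n → b i < b (i + 1) ∨ u = 1 ∧ v = 1 ∧ b i ≤ b (i + 1)) :
    ∑ M ∈ triangles n b, u ^ invMT n M * v ^ invMT' n M = rowConstantTerm u v n b := by
  induction n generalizing b with
  | zero =>
    have : constExp 0 0 = 0 := Subsingleton.elim _ _
    simp [triangles, invMT, invMT', rowConstantTerm, pairProd, this]
  | succ n ih =>
    rw [sum_triangles_succ, rowConstantTerm_succ_eq_sum (fun i hi => hb0 i (by omega))
      (fun i hi => hb i (by omega))]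
    refine Finset.sum_congr rfl fun a ha => ?_
    obtain ⟨a1, a2, -⟩ := mem_interlacingRows.1 ha
    rw [← ih (fun i hi => (hb0 i (by omega)).trans (a1 i hi).1) (fun i hi => .inl (a2 i hi)),
      Finset.mul_sum]
    refine Finset.sum_congr rfl fun M hM => ?_
    have hMa := (mem_triangles.1 hM).2
    rw [pow_invMT_addRow u hMa, pow_invMT'_addRow v hMa]
    simp only [entryWeight, Finset.prod_mul_distrib]
    ring

end Triangles

section Transport

open MvPolynomial

theorem prod_Icc_one_eq_prod_fin {S : Type*} [CommMonoid S] (n : ℕ) (f : ℕ → S) :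
    ∏ i ∈ Finset.Icc 1 n, f i = ∏ i : Fin n, f (i + 1) := by
  rw [← Finset.prod_range fun i => f (i + 1), Finset.range_eq_Ico, Finset.prod_Ico_add' f 0 n 1]
  rfl

variable {R : Type*} [CommRing R]

theorem mapDomain_constExp (n : ℕ) :
    (constExp n (n - 1)).mapDomain (fun i : Fin n => (i : ℕ) + 1) = ctdeg n := by
  rw [← Finsupp.univ_sum_single (constExp n (n - 1)), Finsupp.mapDomain_finsetSum, ctdeg]
  simp only [Finsupp.mapDomain_single, constExp_apply]
  exact (prod_Icc_one_eq_prod_fin (S := Multiplicative (ℕ →₀ ℕ)) n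
    fun i => Multiplicative.ofAdd (Finsupp.single i (n - 1))).symm

theorem coeff_ctdeg_eq_rowConstantTerm (u v : R) (n : ℕ) (b : ℕ → ℤ) :
    coeff (ctdeg n) ((∏ i ∈ Finset.Icc 1 n, (1 + X i) ^ (b i).toNat) *
      ∏ p ∈ (Finset.Icc 1 n ×ˢ Finset.Icc 1 n).filter (fun p => p.1 < p.2),
        (X p.1 - X p.2) * pairFactor (C u) (C v) (X p.1) (X p.2) : MvPolynomial ℕ R) =
      rowConstantTerm u v n fun i => b (i + 1) := by
  have hinj : Function.Injective fun i : Fin n => (i : ℕ) + 1 := fun i j h => by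
    simpa [Fin.val_inj] using h
  rw [rowConstantTerm, ← coeff_rename_mapDomain _ hinj, mapDomain_constExp, pairProd,
    Finset.prod_filter, Finset.prod_product]
  simp only [prod_Icc_one_eq_prod_fin n, map_mul, map_prod, map_pow, map_add, map_one, rename_X,
    apply_ite (rename fun i : Fin n => (i : ℕ) + 1), pairFactor, map_sub, rename_C,
    add_lt_add_iff_right, Fin.val_fin_lt]

theorem setOf_isMT_eq_triangles (n : ℕ) (b : ℕ → ℤ) :
    {M : ℕ → ℕ → ℤ | IsMT n M ∧ ∀ j ∈ Finset.Icc 1 n, M n j = b j} =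
      triangles n fun i => b (i + 1) := by
  ext M
  simp only [Set.mem_ofPred_eq, Finset.mem_coe, mem_triangles, Finset.mem_Icc]
  refine and_congr_right fun _ => ⟨fun h j hj => h (j + 1) (by omega), fun h j hj => ?_⟩
  obtain ⟨j, rfl⟩ := Nat.exists_eq_add_of_le' hj.1
  exact h j (by omega)

end Transport

/-- The generating function of monotone triangles with bottom row `b_1 < … < b_n` w.r.t. the
two inversion numbers is the constant term of
`∏ (1+x_i)^{b_i} x_i^{−n+1} ∏_{i<j} (x_i−x_j)(1+(1−v)x_i+u(x_j+x_i x_j))`;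
for `u = v = 1` weak increase of the bottom row suffices. -/
theorem stmt1 (n : ℕ) (hn : 1 ≤ n) (b : ℕ → ℤ) (hb0 : 0 ≤ b 1) :
    ((∀ i, 1 ≤ i → i < n → b i < b (i+1)) →
      (∑ᶠ M ∈ {M : ℕ → ℕ → ℤ | IsMT n M ∧ ∀ j ∈ Finset.Icc 1 n, M n j = b j},
          Uv ^ invMT n M * Vv ^ invMT' n M) =
      MvPolynomial.coeff (ctdeg n)
        ((∏ i ∈ Finset.Icc 1 n, (1 + MvPolynomial.X i) ^ (b i).toNat) *
          ∏ p ∈ (Finset.Icc 1 n ×ˢ Finset.Icc 1 n).filter (fun p => p.1 < p.2),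
            ((MvPolynomial.X p.1 - MvPolynomial.X p.2) *
              (1 + MvPolynomial.C (1 - Vv) * MvPolynomial.X p.1 +
                MvPolynomial.C Uv *
                  (MvPolynomial.X p.2 + MvPolynomial.X p.1 * MvPolynomial.X p.2)) :
              MvPolynomial ℕ S2))) ∧
    ((∀ i, 1 ≤ i → i < n → b i ≤ b (i+1)) →
      (Set.ncard {M : ℕ → ℕ → ℤ | IsMT n M ∧ ∀ j ∈ Finset.Icc 1 n, M n j = b j} : ℚ) =
      MvPolynomial.coeff (ctdeg n)
        ((∏ i ∈ Finset.Icc 1 n, (1 + MvPolynomial.X i) ^ (b i).toNat) *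
          ∏ p ∈ (Finset.Icc 1 n ×ˢ Finset.Icc 1 n).filter (fun p => p.1 < p.2),
            ((MvPolynomial.X p.1 - MvPolynomial.X p.2) *
              (1 + MvPolynomial.X p.2 + MvPolynomial.X p.1 * MvPolynomial.X p.2) :
              MvPolynomial ℕ ℚ))) := by
  have hnonneg (h : ∀ i, 1 ≤ i → i < n → b i ≤ b (i + 1)) : ∀ i < n, 0 ≤ b (i + 1) := by
    intro i hi
    induction i with
    | zero => exact hb0
    | succ i ih => exact (ih (by omega)).trans (h (i + 1) (by omega) hi)
  rw [setOf_isMT_eq_triangles, finsum_mem_coe_finset, Set.ncard_coe_finset]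
  refine ⟨fun h => ?_, fun h => ?_⟩
  · rw [sum_triangles_eq_rowConstantTerm (hnonneg fun i hi hin => (h i hi hin).le)
      (fun i hi => .inl (h (i + 1) (by omega) hi)), ← coeff_ctdeg_eq_rowConstantTerm]
    simp only [pairFactor, MvPolynomial.C_sub, MvPolynomial.C_1]
  · have key := sum_triangles_eq_rowConstantTerm (u := (1 : ℚ)) (v := 1) (hnonneg h)
      (fun i hi => .inr ⟨rfl, rfl, h (i + 1) (by omega) hi⟩)
    rw [← coeff_ctdeg_eq_rowConstantTerm] at key
    simpa [pairFactor, add_assoc] using key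
end
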